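/- arXiv:1210.5705 — 2 statements merged into one kernel-verified Lean document; each statement's English description precedes it below -/
import Mathlib

section
/- Let n ≥ 2 be an integer and α ∈ ℝ with α ≠ 4-n, and set γ = (n-4+α)(n-α)/4. Assume that γ + k(n-2+k) ≠ 0 for every integer k ≥ 0. Then there exists a constant c > 0 such that ∫_{ℝⁿ} |x|^α |Δu(x)|² dx ≥ c ∫_{ℝⁿ} |x|^{α-2} |∇u(x)|² dx for every function u : ℝⁿ → ℝ of class C² with compact support contained in ℝⁿ \ {0}. -/
open MeasureTheory

noncomputable def lap {n : ℕ} (u : EuclideanSpace ℝ (Fin n) → ℝ)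
    (x : EuclideanSpace ℝ (Fin n)) : ℝ :=
  ∑ i : Fin n, iteratedFDeriv ℝ 2 u x ![EuclideanSpace.single i 1, EuclideanSpace.single i 1]

section Polar
variable {E : Type*} [NormedAddCommGroup E] [NormedSpace ℝ E] [MeasurableSpace E] [BorelSpace E]
  [FiniteDimensional ℝ E] (μ : Measure E) [μ.IsAddHaarMeasure]

lemma integral_volumeIoiPow (m : ℕ) (f : ℝ → ℝ) :
    ∫ r : Set.Ioi (0 : ℝ), f r ∂(Measure.volumeIoiPow m) =
      ∫ r in Set.Ioi (0 : ℝ), r ^ m * f r := by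
  simp only [Measure.volumeIoiPow, ENNReal.ofReal]
  rw [integral_withDensity_eq_integral_smul,
    integral_subtype_comap measurableSet_Ioi fun a ↦ Real.toNNReal (a ^ m) • f a,
    setIntegral_congr_fun measurableSet_Ioi fun x hx ↦ ?_]
  · rw [NNReal.smul_def, Real.coe_toNNReal _ (pow_nonneg hx.out.le _), smul_eq_mul]
  · exact (measurable_subtype_coe.pow_const _).real_toNNReal

lemma integral_eq_integral_sphere_prod [Nontrivial E] (f : E → ℝ) :
    ∫ x, f x ∂μ = ∫ p : Metric.sphere (0 : E) 1 × Set.Ioi (0 : ℝ), f ((p.2 : ℝ) • (p.1 : E))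
      ∂(μ.toSphere.prod (Measure.volumeIoiPow (Module.finrank ℝ E - 1))) := by
  have h := (μ.measurePreserving_homeomorphUnitSphereProd).integral_comp
    (Homeomorph.measurableEmbedding _)
    (fun p : Metric.sphere (0 : E) 1 × Set.Ioi (0 : ℝ) => f ((p.2 : ℝ) • (p.1 : E)))
  conv_lhs => rw [← restrict_compl_singleton (μ := μ) 0]
  rw [← h, ← integral_subtype_comap (measurableSet_singleton _).compl]
  apply integral_congr_ae
  filter_upwards with x
  have hx : ‖(x : E)‖ ≠ 0 := norm_ne_zero_iff.2 x.2
  simp [smul_smul, hx]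

/-- If the integral of a function along every ray (with the polar density) is nonnegative,
then so is its integral. -/
lemma integral_nonneg_of_forall_ray [Nontrivial E] (f : E → ℝ)
    (h : ∀ θ : E, ‖θ‖ = 1 →
      0 ≤ ∫ r in Set.Ioi (0 : ℝ), r ^ (Module.finrank ℝ E - 1) * f (r • θ)) :
    0 ≤ ∫ x, f x ∂μ := by
  rw [integral_eq_integral_sphere_prod]
  by_cases hf : Integrable (fun p : Metric.sphere (0 : E) 1 × Set.Ioi (0 : ℝ) =>
      f ((p.2 : ℝ) • (p.1 : E)))
      (μ.toSphere.prod (Measure.volumeIoiPow (Module.finrank ℝ E - 1)))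
  · rw [integral_prod _ hf]
    refine integral_nonneg fun θ => ?_
    rw [integral_volumeIoiPow _ fun r => f (r • (θ : E))]
    exact h θ (by simp)
  · rw [integral_undef hf]

/-- The integral of a radial function times a homogeneous function splits. -/
lemma integral_norm_mul_homogeneous [Nontrivial E] (φ : ℝ → ℝ) (g : E → ℝ) (k : ℕ)
    (hg : ∀ (r : ℝ) (x : E), g (r • x) = r ^ k * g x) :
    ∫ x, φ ‖x‖ * g x ∂μ = (∫ θ : Metric.sphere (0 : E) 1, g θ ∂μ.toSphere) *
      ∫ r in Set.Ioi (0 : ℝ), r ^ (Module.finrank ℝ E - 1) * (φ r * r ^ k) := by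
  rw [integral_eq_integral_sphere_prod, ← integral_volumeIoiPow _ fun r => φ r * r ^ k,
    ← integral_prod_mul]
  refine integral_congr_ae (Filter.Eventually.of_forall fun p => ?_)
  have h1 : ‖(p.1 : E)‖ = 1 := by simp
  have h2 : (0 : ℝ) < p.2 := p.2.2
  simp only [norm_smul, h1, Real.norm_eq_abs, abs_of_pos h2, hg, mul_one]
  ring

end Polar

section HarmonicPolynomials
open MvPolynomial

variable {n : ℕ}

/-- The Laplacian of a polynomial. -/
noncomputable def polyLap (p : MvPolynomial (Fin n) ℝ) : MvPolynomial (Fin n) ℝ :=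
  ∑ i, pderiv i (pderiv i p)

/-- The polynomial `∑ Xᵢ²`. -/
noncomputable def normSqPoly (n : ℕ) : MvPolynomial (Fin n) ℝ := ∑ i, X i ^ 2

/-- Span of the products of a power of `∑ Xᵢ²` with a harmonic homogeneous polynomial,
of total degree `k`. -/
noncomputable def harmonicSpan (n k : ℕ) : Submodule ℝ (MvPolynomial (Fin n) ℝ) :=
  Submodule.span ℝ {p | ∃ (j d : ℕ) (Y : MvPolynomial (Fin n) ℝ), Y.IsHomogeneous d ∧
    polyLap Y = 0 ∧ 2 * j + d = k ∧ p = normSqPoly n ^ j * Y}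

lemma polyLap_add (p q : MvPolynomial (Fin n) ℝ) : polyLap (p + q) = polyLap p + polyLap q := by
  simp [polyLap, Finset.sum_add_distrib]

lemma polyLap_sub (p q : MvPolynomial (Fin n) ℝ) : polyLap (p - q) = polyLap p - polyLap q := by
  simp [polyLap, Finset.sum_sub_distrib]

lemma polyLap_smul (c : ℝ) (p : MvPolynomial (Fin n) ℝ) : polyLap (c • p) = c • polyLap p := by
  simp [polyLap, Finset.smul_sum]

lemma pderiv_normSqPoly (i : Fin n) : pderiv i (normSqPoly n) = 2 * X i := by
  classical
  simp [normSqPoly, pderiv_X, Derivation.leibniz_pow, Pi.single_apply]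

lemma polyLap_normSqPoly_pow_mul (j d : ℕ) {Y : MvPolynomial (Fin n) ℝ} (hY : Y.IsHomogeneous d)
    (hΔ : polyLap Y = 0) :
    polyLap (normSqPoly n ^ (j + 1) * Y) =
      (2 * (j + 1) * (n + 2 * d + 2 * j) : ℝ) • (normSqPoly n ^ j * Y) := by
  have hE : ∑ i, X i * pderiv i Y = (d : MvPolynomial (Fin n) ℝ) * Y := by
    rw [hY.sum_X_mul_pderiv, nsmul_eq_mul]
  have hi : ∀ i : Fin n, pderiv i (pderiv i (normSqPoly n ^ (j + 1) * Y)) =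
      (4 * ((j : MvPolynomial (Fin n) ℝ) + 1) * (j : MvPolynomial (Fin n) ℝ) *
        normSqPoly n ^ (j - 1) * Y) * X i ^ 2 +
      2 * ((j : MvPolynomial (Fin n) ℝ) + 1) * normSqPoly n ^ j * Y +
      (4 * ((j : MvPolynomial (Fin n) ℝ) + 1) * normSqPoly n ^ j) * (X i * pderiv i Y)
      + normSqPoly n ^ (j + 1) * pderiv i (pderiv i Y) := by
    intro i
    have hpow : ∀ m : ℕ, pderiv i (normSqPoly n ^ m) =
        (m : MvPolynomial (Fin n) ℝ) * normSqPoly n ^ (m - 1) * (2 * X i) := by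
      intro m
      rw [Derivation.leibniz_pow, pderiv_normSqPoly]
      simp [mul_assoc]
    have h2 : pderiv i (2 : MvPolynomial (Fin n) ℝ) = 0 := by
      simpa using (pderiv i).map_natCast (A := MvPolynomial (Fin n) ℝ) 2
    simp only [pderiv_mul, hpow, map_add, Nat.add_sub_cancel, h2, pderiv_X_self,
      Derivation.map_natCast]
    push_cast
    ring
  have hQ : (j : MvPolynomial (Fin n) ℝ) * normSqPoly n ^ (j - 1) * normSqPoly n =
      j * normSqPoly n ^ j := by
    cases j with
    | zero => simp
    | succ m => simp [pow_succ, mul_assoc]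
  have hΔ' : ∑ i, pderiv i (pderiv i Y) = 0 := hΔ
  rw [polyLap, Finset.sum_congr rfl fun i _ => hi i]
  simp only [Finset.sum_add_distrib, ← Finset.mul_sum, hE, hΔ', mul_zero, add_zero,
    Finset.sum_const, Finset.card_univ, Fintype.card_fin, nsmul_eq_mul]
  rw [show ∑ i : Fin n, (X i : MvPolynomial (Fin n) ℝ) ^ 2 = normSqPoly n from rfl,
    MvPolynomial.smul_eq_C_mul]
  simp only [map_mul, map_add, map_natCast, map_one, map_ofNat]
  linear_combination (4 * (j + 1) * Y) * hQ

lemma isHomogeneous_normSqPoly : (normSqPoly n).IsHomogeneous 2 :=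
  IsHomogeneous.sum _ _ _ fun i _ => by simpa using (isHomogeneous_X ℝ i).pow 2

lemma isHomogeneous_of_mem_harmonicSpan {k : ℕ} {p : MvPolynomial (Fin n) ℝ}
    (hp : p ∈ harmonicSpan n k) : p.IsHomogeneous k := by
  have : harmonicSpan n k ≤ homogeneousSubmodule (Fin n) ℝ k := by
    refine Submodule.span_le.2 ?_
    rintro _ ⟨j, d, Y, hY, -, rfl, rfl⟩
    exact (isHomogeneous_normSqPoly.pow j).mul hY
  exact this hp

lemma exists_polyLap_eq (hn : n ≠ 0) {k : ℕ} {q : MvPolynomial (Fin n) ℝ}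
    (hq : q ∈ harmonicSpan n k) : ∃ p ∈ harmonicSpan n (k + 2), polyLap p = q := by
  induction hq using Submodule.span_induction with
  | mem q h =>
    obtain ⟨j, d, Y, hY, hΔ, hk, rfl⟩ := h
    have hc : (2 * (j + 1) * (n + 2 * d + 2 * j) : ℝ) ≠ 0 := by
      have : (0 : ℝ) < n := by exact_mod_cast Nat.pos_of_ne_zero hn
      positivity
    refine ⟨(2 * (j + 1) * (n + 2 * d + 2 * j) : ℝ)⁻¹ • (normSqPoly n ^ (j + 1) * Y),
      Submodule.smul_mem _ _ (Submodule.subset_span ⟨j + 1, d, Y, hY, hΔ, by omega, rfl⟩), ?_⟩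
    rw [polyLap_smul, polyLap_normSqPoly_pow_mul j d hY hΔ, smul_smul, inv_mul_cancel₀ hc, one_smul]
  | zero => exact ⟨0, Submodule.zero_mem _, by simp [polyLap]⟩
  | add x y _ _ hx hy =>
    obtain ⟨p, hp, rfl⟩ := hx
    obtain ⟨p', hp', rfl⟩ := hy
    exact ⟨p + p', Submodule.add_mem _ hp hp', polyLap_add _ _⟩
  | smul c x _ hx =>
    obtain ⟨p, hp, rfl⟩ := hx
    exact ⟨c • p, Submodule.smul_mem _ _ hp, polyLap_smul _ _⟩

lemma mem_harmonicSpan_of_polyLap_eq_zero {k : ℕ} {p : MvPolynomial (Fin n) ℝ}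
    (hp : p.IsHomogeneous k) (h : polyLap p = 0) : p ∈ harmonicSpan n k :=
  Submodule.subset_span ⟨0, k, p, hp, h, by simp, by simp⟩

/-- Every homogeneous polynomial is a combination of products of powers of `∑ Xᵢ²` and harmonic
homogeneous polynomials. -/
lemma mem_harmonicSpan_of_isHomogeneous (hn : n ≠ 0) (k : ℕ) :
    ∀ p : MvPolynomial (Fin n) ℝ, p.IsHomogeneous k → p ∈ harmonicSpan n k := by
  have hlow : ∀ k < 2, ∀ p : MvPolynomial (Fin n) ℝ, p.IsHomogeneous k → polyLap p = 0 := by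
    intro k hk p hp
    refine Finset.sum_eq_zero fun i _ => ?_
    have h0 : (pderiv i p).IsHomogeneous 0 := by
      have := hp.pderiv (i := i)
      rwa [show k - 1 = 0 by omega] at this
    rw [← totalDegree_zero_iff_isHomogeneous, totalDegree_eq_zero_iff_eq_C] at h0
    rw [h0, pderiv_C]
  induction k using Nat.twoStepInduction with
  | zero =>
    exact fun p hp => mem_harmonicSpan_of_polyLap_eq_zero hp (hlow 0 (by norm_num) p hp)
  | one =>
    exact fun p hp => mem_harmonicSpan_of_polyLap_eq_zero hp (hlow 1 (by norm_num) p hp)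
  | more k ih _ =>
    intro p hp
    have hΔ : (polyLap p).IsHomogeneous k :=
      IsHomogeneous.sum _ _ _ fun i _ => (hp.pderiv (i := i)).pderiv (i := i)
    obtain ⟨p', hp', he⟩ := exists_polyLap_eq hn (ih _ hΔ)
    have hd : p - p' ∈ harmonicSpan n (k + 2) := by
      refine mem_harmonicSpan_of_polyLap_eq_zero
        (hp.sub (isHomogeneous_of_mem_harmonicSpan hp')) ?_
      rw [polyLap_sub, he, sub_self]
    simpa using Submodule.add_mem _ hd hp'

end HarmonicPolynomials

section PartialDerivatives

variable {n : ℕ}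

/-- The `i`-th partial derivative. -/
noncomputable def partialD (i : Fin n) (f : EuclideanSpace ℝ (Fin n) → ℝ)
    (x : EuclideanSpace ℝ (Fin n)) : ℝ :=
  fderiv ℝ f x (EuclideanSpace.single i 1)

variable {f g : EuclideanSpace ℝ (Fin n) → ℝ} {x : EuclideanSpace ℝ (Fin n)} {i : Fin n}

lemma partialD_mul (hf : DifferentiableAt ℝ f x) (hg : DifferentiableAt ℝ g x) :
    partialD i (fun y => f y * g y) x = partialD i f x * g x + f x * partialD i g x := by
  simp only [partialD]
  rw [fderiv_fun_mul hf hg]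
  simp
  ring

lemma partialD_add (hf : DifferentiableAt ℝ f x) (hg : DifferentiableAt ℝ g x) :
    partialD i (fun y => f y + g y) x = partialD i f x + partialD i g x := by
  simp only [partialD]
  rw [fderiv_fun_add hf hg]
  simp

lemma partialD_sub (hf : DifferentiableAt ℝ f x) (hg : DifferentiableAt ℝ g x) :
    partialD i (fun y => f y - g y) x = partialD i f x - partialD i g x := by
  simp only [partialD]
  rw [fderiv_fun_sub hf hg]
  simp

lemma partialD_congr (h : f =ᶠ[nhds x] g) : partialD i f x = partialD i g x := by
  simp only [partialD, h.fderiv_eq]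

lemma contDiffAt_partialD {k m : WithTop ℕ∞} (hf : ContDiffAt ℝ k f x) (h : m + 1 ≤ k) :
    ContDiffAt ℝ m (partialD i f) x :=
  (hf.fderiv_right h).clm_apply contDiffAt_const

lemma partialD_coord (j : Fin n) :
    partialD i (fun y : EuclideanSpace ℝ (Fin n) => y j) x = if i = j then 1 else 0 := by
  have : HasFDerivAt (fun y : EuclideanSpace ℝ (Fin n) => y j)
      (EuclideanSpace.proj (𝕜 := ℝ) j : EuclideanSpace ℝ (Fin n) →L[ℝ] ℝ) x :=
    (EuclideanSpace.proj (𝕜 := ℝ) j : EuclideanSpace ℝ (Fin n) →L[ℝ] ℝ).hasFDerivAt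
  rw [partialD, this.fderiv]
  simp [eq_comm]

lemma partialD_comp {φ : ℝ → ℝ} {φ' : ℝ} (hφ : HasDerivAt φ φ' (f x))
    (hf : DifferentiableAt ℝ f x) : partialD i (fun y => φ (f y)) x = φ' * partialD i f x := by
  have := hφ.comp_hasFDerivAt x hf.hasFDerivAt
  rw [partialD, show (fun y => φ (f y)) = φ ∘ f from rfl, this.fderiv]
  simp [partialD]

lemma partialD_norm (hx : x ≠ 0) : partialD i (fun y => ‖y‖) x = x i / ‖x‖ := by
  have h := (contDiffAt_norm ℝ (n := 1) hx).differentiableAt one_ne_zero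
  have h2 : partialD i (fun y : EuclideanSpace ℝ (Fin n) => ‖y‖ ^ 2) x = 2 * x i := by
    rw [partialD, (hasStrictFDerivAt_norm_sq x).hasFDerivAt.fderiv]
    simp [EuclideanSpace.inner_single_right]
  rw [partialD_comp (f := fun y => ‖y‖) (φ := fun t => t ^ 2) (hasDerivAt_pow 2 ‖x‖) h] at h2
  have : ‖x‖ ≠ 0 := norm_ne_zero_iff.2 hx
  field_simp
  simp at h2
  linarith

lemma partialD_radial {φ : ℝ → ℝ} {φ' : ℝ} (hx : x ≠ 0) (hφ : HasDerivAt φ φ' ‖x‖) :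
    partialD i (fun y => φ ‖y‖) x = φ' * (x i / ‖x‖) := by
  rw [partialD_comp (f := fun y => ‖y‖) hφ
    ((contDiffAt_norm ℝ (n := 1) hx).differentiableAt one_ne_zero), partialD_norm hx]

lemma sum_sq_eq_norm_sq (x : EuclideanSpace ℝ (Fin n)) : ∑ i, x i * x i = ‖x‖ ^ 2 := by
  rw [EuclideanSpace.norm_sq_eq]
  simp [sq]

lemma tsupport_partialD_subset : tsupport (partialD i f) ⊆ tsupport f :=
  closure_minimal (fun _ hy => support_fderiv_subset ℝ (f := f) fun h => hy (by
    simp [partialD, h])) (isClosed_tsupport f)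

lemma sum_partialD_sq :
    ∑ i, partialD i f x ^ 2 = ‖gradient f x‖ ^ 2 := by
  rw [EuclideanSpace.norm_sq_eq]
  refine Finset.sum_congr rfl fun i _ => ?_
  rw [partialD, Real.norm_eq_abs, sq_abs]
  congr 1
  have := InnerProductSpace.toDual_symm_apply (𝕜 := ℝ) (x := EuclideanSpace.single i (1 : ℝ))
    (y := fderiv ℝ f x)
  rw [← this, EuclideanSpace.inner_single_right]
  simp [gradient]

lemma lap_eq_sum_partialD {u : EuclideanSpace ℝ (Fin n) → ℝ} (hu : ContDiff ℝ 2 u)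
    (x : EuclideanSpace ℝ (Fin n)) : lap u x = ∑ i, partialD i (partialD i u) x := by
  refine Finset.sum_congr rfl fun i _ => ?_
  rw [iteratedFDeriv_two_apply]
  have hd : DifferentiableAt ℝ (fderiv ℝ u) x :=
    (hu.fderiv_right (m := 1) (by norm_num)).differentiable one_ne_zero x
  simp only [Matrix.cons_val_zero, Matrix.cons_val_one]
  rw [partialD, show partialD i u = (fun y => (fderiv ℝ u y) (EuclideanSpace.single i 1)) from rfl,
    show (fun y => (fderiv ℝ u y) (EuclideanSpace.single i 1)) = fun y => (fderiv ℝ u y)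
    ((fun _ => EuclideanSpace.single i 1) y) from rfl,
    fderiv_clm_apply hd (differentiableAt_const _)]
  simp

lemma contDiff_of_contDiffAt_tsupport {k : WithTop ℕ∞} (h : ∀ x ∈ tsupport f, ContDiffAt ℝ k f x) :
    ContDiff ℝ k f := by
  refine contDiff_iff_contDiffAt.2 fun x => ?_
  by_cases hx : x ∈ tsupport f
  · exact h x hx
  · exact contDiffAt_const.congr_of_eventuallyEq (notMem_tsupport_iff_eventuallyEq.1 hx)

lemma integrable_of_continuousAt_tsupport {K : Set (EuclideanSpace ℝ (Fin n))} (hK : IsCompact K)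
    (hs : tsupport f ⊆ K) (h : ∀ x ∈ K, ContinuousAt f x) : Integrable f :=
  (continuous_of_tsupport fun x hx => h x (hs hx)).integrable_of_hasCompactSupport
    (HasCompactSupport.of_support_subset_isCompact hK (subset_closure.trans hs))

lemma integral_partialD_eq_zero (hf : ContDiff ℝ 1 f) (hc : HasCompactSupport f) (i : Fin n) :
    ∫ x, partialD i f x = 0 := by
  have hi : Integrable (fun x => partialD i f x) := by
    refine Continuous.integrable_of_hasCompactSupport ?_
      (hc.mono' (subset_closure.trans tsupport_partialD_subset))
    exact (hf.continuous_fderiv one_ne_zero).clm_apply continuous_const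
  have := integral_mul_fderiv_eq_neg_fderiv_mul_of_integrable (μ := volume)
    (f := fun _ : EuclideanSpace ℝ (Fin n) => (1 : ℝ)) (g := f) (v := EuclideanSpace.single i 1)
    (by simp) (by simpa [partialD] using hi)
    (by simpa using hf.continuous.integrable_of_hasCompactSupport hc)
    (fun _ _ => differentiableAt_const _)
    (fun x _ => hf.differentiable one_ne_zero x)
  simpa [partialD] using this

/-- The divergence theorem for a compactly supported vector field. -/
lemma integral_sum_partialD_eq_zero {F : Fin n → EuclideanSpace ℝ (Fin n) → ℝ}
    (hF : ∀ i, ContDiff ℝ 1 (F i)) (hc : ∀ i, HasCompactSupport (F i)) :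
    ∫ x, ∑ i, partialD i (F i) x = 0 := by
  rw [integral_finsetSum]
  · exact Finset.sum_eq_zero fun i _ => integral_partialD_eq_zero (hF i) (hc i) i
  · intro i _
    refine Continuous.integrable_of_hasCompactSupport ?_ ?_
    · exact ((hF i).continuous_fderiv one_ne_zero).clm_apply continuous_const
    · exact (hc i).mono' (subset_closure.trans tsupport_partialD_subset)

/-- Green's second identity for a compactly supported function `u` and a function `v` which is
`C²` on the support of `u`. -/
lemma integral_mul_lap_eq {u v : EuclideanSpace ℝ (Fin n) → ℝ} (hu : ContDiff ℝ 2 u)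
    (hc : HasCompactSupport u) (hv : ∀ x ∈ tsupport u, ContDiffAt ℝ 2 v x) :
    ∫ x, v x * lap u x = ∫ x, u x * ∑ i, partialD i (partialD i v) x := by
  have hlap : lap u = fun x => ∑ i, partialD i (partialD i u) x :=
    funext (lap_eq_sum_partialD hu)
  have hpu : ∀ i, ContDiff ℝ 1 (partialD i u) := fun i =>
    contDiff_iff_contDiffAt.2 fun x => contDiffAt_partialD hu.contDiffAt (by norm_num)
  have hpv : ∀ i, ∀ x ∈ tsupport u, ContDiffAt ℝ 1 (partialD i v) x := fun i x hx =>
    contDiffAt_partialD (hv x hx) (by norm_num)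
  have hppu : ∀ i, Continuous (partialD i (partialD i u)) := fun i =>
    (contDiff_iff_contDiffAt.2 fun x => contDiffAt_partialD (m := 0) (hpu i).contDiffAt
      (by norm_num)).continuous
  have hs1 : ∀ i, tsupport (fun x => v x * partialD i u x) ⊆ tsupport u := fun i =>
    (tsupport_mul_subset_right (f := v)).trans tsupport_partialD_subset
  have hs2 : ∀ i, tsupport (fun x => u x * partialD i v x) ⊆ tsupport u := fun i =>
    tsupport_mul_subset_left (f := u)
  have hA : ∀ i, ContDiff ℝ 1 (fun x => v x * partialD i u x) := fun i =>
    contDiff_of_contDiffAt_tsupport fun x hx =>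
      ((hv x (hs1 i hx)).of_le (by norm_num)).mul (hpu i).contDiffAt
  have hB : ∀ i, ContDiff ℝ 1 (fun x => u x * partialD i v x) := fun i =>
    contDiff_of_contDiffAt_tsupport fun x hx =>
      (hu.contDiffAt.of_le (by norm_num)).mul (hpv i x (hs2 i hx))
  have hdiv := integral_sum_partialD_eq_zero
    (F := fun i x => v x * partialD i u x - u x * partialD i v x)
    (fun i => (hA i).sub (hB i))
    (fun i => (HasCompactSupport.of_support_subset_isCompact hc.isCompact
      (subset_closure.trans (hs1 i))).sub (HasCompactSupport.of_support_subset_isCompact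
        hc.isCompact (subset_closure.trans (hs2 i))))
  have hpt : ∀ x, ∑ i, partialD i (fun x => v x * partialD i u x - u x * partialD i v x) x =
      v x * lap u x - u x * ∑ i, partialD i (partialD i v) x := by
    intro x
    rw [hlap]
    simp only [Finset.mul_sum, ← Finset.sum_sub_distrib]
    refine Finset.sum_congr rfl fun i _ => ?_
    by_cases hx : x ∈ tsupport u
    · rw [partialD_sub ((hA i).differentiable one_ne_zero x) ((hB i).differentiable one_ne_zero x),
        partialD_mul ((hv x hx).differentiableAt two_ne_zero)
          ((hpu i).differentiable one_ne_zero x),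
        partialD_mul (hu.differentiable two_ne_zero x)
          ((hpv i x hx).differentiableAt one_ne_zero)]
      ring
    · have h1 : u =ᶠ[nhds x] 0 := notMem_tsupport_iff_eventuallyEq.1 hx
      have h2 : partialD i u =ᶠ[nhds x] 0 := notMem_tsupport_iff_eventuallyEq.1
        fun h => hx (tsupport_partialD_subset h)
      have h3 : partialD i (partialD i u) =ᶠ[nhds x] 0 := notMem_tsupport_iff_eventuallyEq.1
        fun h => hx (tsupport_partialD_subset (tsupport_partialD_subset h))
      have h4 : (fun x => v x * partialD i u x - u x * partialD i v x) =ᶠ[nhds x]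
          fun _ => 0 := by
        filter_upwards [h1, h2] with y hy1 hy2
        simp [hy1, hy2]
      rw [partialD_congr h4, h1.eq_of_nhds, h3.eq_of_nhds]
      simp [partialD]
  have hiA : Integrable fun x => v x * lap u x := by
    refine integrable_of_continuousAt_tsupport hc.isCompact ?_ fun x hx =>
      (hv x hx).continuousAt.mul ?_
    · refine (tsupport_mul_subset_right (f := v)).trans ?_
      refine closure_minimal (fun x hx => ?_) (isClosed_tsupport u)
      by_contra h
      refine hx ?_
      rw [hlap]
      exact Finset.sum_eq_zero fun i _ => image_eq_zero_of_notMem_tsupport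
        fun h' => h (tsupport_partialD_subset (tsupport_partialD_subset h'))
    · rw [hlap]
      exact (continuous_finsetSum _ fun i _ => hppu i).continuousAt
  have hiB : Integrable fun x => u x * ∑ i, partialD i (partialD i v) x := by
    refine integrable_of_continuousAt_tsupport hc.isCompact (tsupport_mul_subset_left (f := u))
      fun x hx => hu.continuous.continuousAt.mul ?_
    exact tendsto_finsetSum _ fun i _ =>
      (contDiffAt_partialD (m := 0) (hpv i x hx) (by norm_num)).continuousAt
  rw [integral_congr_ae (Filter.Eventually.of_forall hpt), integral_sub hiA hiB] at hdiv
  linarith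

end PartialDerivatives

section PolynomialFunctions
open MvPolynomial

variable {n : ℕ}

/-- The polynomial function on Euclidean space attached to a polynomial. -/
noncomputable def polyFun (p : MvPolynomial (Fin n) ℝ) (x : EuclideanSpace ℝ (Fin n)) : ℝ :=
  eval (fun i => x i) p

lemma contDiff_polyFun (p : MvPolynomial (Fin n) ℝ) {k : WithTop ℕ∞} :
    ContDiff ℝ k (polyFun p) := by
  induction p using MvPolynomial.induction_on with
  | C a =>
    have : polyFun (C a : MvPolynomial (Fin n) ℝ) = fun _ => a := by ext; simp [polyFun]
    exact this ▸ contDiff_const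
  | add p q hp hq =>
    have : polyFun (p + q) = fun x => polyFun p x + polyFun q x := by ext; simp [polyFun]
    exact this ▸ hp.add hq
  | mul_X p i hp =>
    have : polyFun (p * X i) = fun x => polyFun p x * x i := by ext; simp [polyFun]
    rw [this]
    refine hp.mul ?_
    exact (EuclideanSpace.proj (𝕜 := ℝ) i : EuclideanSpace ℝ (Fin n) →L[ℝ] ℝ).contDiff

lemma partialD_polyFun (p : MvPolynomial (Fin n) ℝ) (i : Fin n) :
    partialD i (polyFun p) = polyFun (pderiv i p) := by
  classical
  ext x
  have hd : ∀ q : MvPolynomial (Fin n) ℝ, DifferentiableAt ℝ (polyFun q) x := fun q =>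
    (contDiff_polyFun q (k := 1)).differentiable one_ne_zero x
  induction p using MvPolynomial.induction_on with
  | C a =>
    have : polyFun (C a : MvPolynomial (Fin n) ℝ) = fun _ => a := by ext; simp [polyFun]
    rw [this]
    simp [partialD, polyFun]
  | add p q hp hq =>
    have : polyFun (p + q) = fun x => polyFun p x + polyFun q x := by ext; simp [polyFun]
    rw [this, partialD_add (hd p) (hd q), hp, hq]
    simp [polyFun]
  | mul_X p j hp =>
    have : polyFun (p * X j) = fun x => polyFun p x * x j := by ext; simp [polyFun]
    have hj : DifferentiableAt ℝ (fun x : EuclideanSpace ℝ (Fin n) => x j) x :=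
      (EuclideanSpace.proj (𝕜 := ℝ) j : EuclideanSpace ℝ (Fin n) →L[ℝ] ℝ).differentiableAt
    rw [this, partialD_mul (hd p) hj, hp, partialD_coord]
    simp only [polyFun, pderiv_mul, pderiv_X, map_add, map_mul, eval_X, Pi.single_apply]
    by_cases h : i = j
    · simp [h]
    · simp [h, Ne.symm h]

lemma polyFun_smul {d : ℕ} {p : MvPolynomial (Fin n) ℝ} (hp : p.IsHomogeneous d) (r : ℝ)
    (x : EuclideanSpace ℝ (Fin n)) : polyFun p (r • x) = r ^ d * polyFun p x := by
  simp only [polyFun, PiLp.smul_apply, smul_eq_mul, eval_eq', Finset.mul_sum]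
  refine Finset.sum_congr rfl fun m hm => ?_
  have hdeg : ∑ i, m i = d := by
    have := hp (mem_support_iff.1 hm)
    rw [← this, Finsupp.weight_apply, Finsupp.sum_fintype _ _ (by simp)]
    simp
  rw [← hdeg, ← Finset.prod_pow_eq_pow_sum]
  simp only [mul_pow, Finset.prod_mul_distrib]
  ring

lemma sum_coord_mul_partialD_polyFun {d : ℕ} {p : MvPolynomial (Fin n) ℝ}
    (hp : p.IsHomogeneous d) (x : EuclideanSpace ℝ (Fin n)) :
    ∑ i, x i * partialD i (polyFun p) x = d * polyFun p x := by
  have := congrArg (fun q => polyFun q x) hp.sum_X_mul_pderiv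
  simp only [partialD_polyFun]
  simpa [polyFun] using this

lemma sum_partialD_partialD_polyFun (p : MvPolynomial (Fin n) ℝ)
    (x : EuclideanSpace ℝ (Fin n)) :
    ∑ i, partialD i (partialD i (polyFun p)) x = polyFun (polyLap p) x := by
  simp [partialD_polyFun, polyFun, polyLap]

lemma integral_norm_mul_polyFun_mul_polyFun_eq_zero [NeZero n] {d e : ℕ} (hde : d ≠ e)
    {Y Z : MvPolynomial (Fin n) ℝ} (hY : Y.IsHomogeneous d) (hΔY : polyLap Y = 0)
    (hZ : Z.IsHomogeneous e) (hΔZ : polyLap Z = 0) (φ : ℝ → ℝ) :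
    ∫ x : EuclideanSpace ℝ (Fin n), φ ‖x‖ * (polyFun Y x * polyFun Z x) = 0 := by
  have hhom : ∀ (r : ℝ) (x : EuclideanSpace ℝ (Fin n)),
      polyFun Y (r • x) * polyFun Z (r • x) = r ^ (d + e) * (polyFun Y x * polyFun Z x) := by
    intro r x
    rw [polyFun_smul hY, polyFun_smul hZ]
    ring
  have hsplit := fun φ : ℝ → ℝ => integral_norm_mul_homogeneous volume φ
    (fun x : EuclideanSpace ℝ (Fin n) => polyFun Y x * polyFun Z x) (d + e) hhom
  rw [hsplit φ]
  set κ : ℝ → ℝ := fun s => max 0 (1 - s) with hκ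
  have hκc : Continuous κ := by fun_prop
  set χ : ℝ → ℝ := fun s => ∫ t in (1 : ℝ)..s, κ t with hχ
  have hχd : ∀ s, HasDerivAt χ (κ s) s := fun s => hκc.integral_hasStrictDerivAt 1 s |>.hasDerivAt
  have hχc : ContDiff ℝ 1 χ := by
    rw [contDiff_one_iff_deriv]
    exact ⟨fun s => (hχd s).differentiableAt, by rwa [funext fun s => (hχd s).deriv]⟩
  have hχ0 : ∀ s, 1 ≤ s → χ s = 0 := by
    intro s hs
    refine intervalIntegral.integral_zero_ae ?_
    refine Filter.Eventually.of_forall fun t ht => ?_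
    rw [Set.uIoc_of_le hs] at ht
    exact max_eq_left (by linarith [ht.1])
  have hkey : ∫ x : EuclideanSpace ℝ (Fin n), κ (‖x‖ ^ 2) * (polyFun Y x * polyFun Z x) = 0 := by
    have hn2 : ContDiff ℝ 1 (fun x : EuclideanSpace ℝ (Fin n) => χ (‖x‖ ^ 2)) :=
      hχc.comp (contDiff_norm_sq ℝ)
    have hG : ∀ i, ContDiff ℝ 1 (fun x : EuclideanSpace ℝ (Fin n) =>
        polyFun Y x * polyFun (pderiv i Z) x - polyFun Z x * polyFun (pderiv i Y) x) := fun i =>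
      ((contDiff_polyFun _).mul (contDiff_polyFun _)).sub
        ((contDiff_polyFun _).mul (contDiff_polyFun _))
    have hdiv := integral_sum_partialD_eq_zero
      (F := fun i (x : EuclideanSpace ℝ (Fin n)) => χ (‖x‖ ^ 2) *
        (polyFun Y x * polyFun (pderiv i Z) x - polyFun Z x * polyFun (pderiv i Y) x))
      (fun i => hn2.mul (hG i)) (fun i => HasCompactSupport.intro
        (isCompact_closedBall (0 : EuclideanSpace ℝ (Fin n)) 1) fun x hx => by
          have : 1 < ‖x‖ := by simpa using hx
          rw [hχ0 _ (by nlinarith), zero_mul])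
    have hpt : ∀ x : EuclideanSpace ℝ (Fin n), ∑ i, partialD i (fun x => χ (‖x‖ ^ 2) *
        (polyFun Y x * polyFun (pderiv i Z) x - polyFun Z x * polyFun (pderiv i Y) x)) x =
        (2 * ((e : ℝ) - d)) * (κ (‖x‖ ^ 2) * (polyFun Y x * polyFun Z x)) := by
      intro x
      have hd : ∀ q : MvPolynomial (Fin n) ℝ, DifferentiableAt ℝ (polyFun q) x := fun q =>
        (contDiff_polyFun q (k := 1)).differentiable one_ne_zero x
      have hχi : ∀ i, partialD i (fun x : EuclideanSpace ℝ (Fin n) => χ (‖x‖ ^ 2)) x =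
          κ (‖x‖ ^ 2) * (2 * x i) := by
        intro i
        rw [partialD_comp (f := fun x : EuclideanSpace ℝ (Fin n) => ‖x‖ ^ 2) (hχd _)
          (hasStrictFDerivAt_norm_sq x).hasFDerivAt.differentiableAt]
        congr 1
        rw [partialD, (hasStrictFDerivAt_norm_sq x).hasFDerivAt.fderiv]
        simp [EuclideanSpace.inner_single_right]
      have hi : ∀ i, partialD i (fun x => χ (‖x‖ ^ 2) *
          (polyFun Y x * polyFun (pderiv i Z) x - polyFun Z x * polyFun (pderiv i Y) x)) x =
          (2 * κ (‖x‖ ^ 2) * polyFun Y x) * (x i * partialD i (polyFun Z) x) -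
          (2 * κ (‖x‖ ^ 2) * polyFun Z x) * (x i * partialD i (polyFun Y) x) +
          (χ (‖x‖ ^ 2) * polyFun Y x) * partialD i (partialD i (polyFun Z)) x -
          (χ (‖x‖ ^ 2) * polyFun Z x) * partialD i (partialD i (polyFun Y)) x := by
        intro i
        rw [partialD_mul (hn2.differentiable one_ne_zero x) ((hG i).differentiable one_ne_zero x),
          partialD_sub ((hd _).fun_mul (hd _)) ((hd _).fun_mul (hd _)), partialD_mul (hd _) (hd _),
          partialD_mul (hd _) (hd _), hχi]
        simp only [partialD_polyFun]
        ring
      rw [Finset.sum_congr rfl fun i _ => hi i]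
      simp only [Finset.sum_add_distrib, Finset.sum_sub_distrib, ← Finset.mul_sum,
        sum_coord_mul_partialD_polyFun hY, sum_coord_mul_partialD_polyFun hZ,
        sum_partialD_partialD_polyFun, hΔY, hΔZ]
      simp only [polyFun, map_zero]
      ring
    rw [integral_congr_ae (Filter.Eventually.of_forall hpt), integral_const_mul] at hdiv
    refine (mul_eq_zero.1 hdiv).resolve_left ?_
    exact mul_ne_zero two_ne_zero (sub_ne_zero.2 (by exact_mod_cast hde.symm))
  rw [hsplit fun r => κ (r ^ 2)] at hkey
  rw [(mul_eq_zero.1 hkey).resolve_right ?_, zero_mul]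
  set m := Module.finrank ℝ (EuclideanSpace ℝ (Fin n)) - 1
  have : ∫ r in Set.Ioi (0 : ℝ), r ^ m * (κ (r ^ 2) * r ^ (d + e)) =
      ∫ r in (0 : ℝ)..1, r ^ m * (κ (r ^ 2) * r ^ (d + e)) := by
    rw [intervalIntegral.integral_of_le zero_le_one]
    refine (setIntegral_eq_of_subset_of_forall_sdiff_eq_zero measurableSet_Ioi
      Set.Ioc_subset_Ioi_self fun r hr => ?_)
    have h0 : 0 < r := hr.1
    have h1 : 1 < r := by
      by_contra h
      exact hr.2 ⟨h0, not_lt.1 h⟩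
    rw [hκ]
    simp only
    rw [max_eq_left (by nlinarith)]
    ring
  rw [this]
  refine (intervalIntegral.intervalIntegral_pos_of_pos_on
    (Continuous.intervalIntegrable (by fun_prop) _ _) (fun r hr => ?_) zero_lt_one).ne'
  have h0 : 0 < r := hr.1
  have h1 : 0 < κ (r ^ 2) := lt_max_of_lt_right (by nlinarith [hr.2])
  positivity

end PolynomialFunctions

section WeightedHardy

variable {ρ R : ℝ}

/-- A weighted Hardy inequality on an interval, for functions vanishing at one endpoint. -/
lemma integral_rpow_mul_sq_le {σ : ℝ} {F G : ℝ → ℝ} (hρ : 0 < ρ) (hR : ρ < R)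
    (hF : ∀ r, 0 < r → HasDerivAt F (G r) r) (hG : ContinuousOn G (Set.Ioi 0))
    (h0 : F (if 0 < σ then R else ρ) = 0) :
    σ ^ 2 * ∫ r in ρ..R, r ^ (σ - 1) * F r ^ 2 ≤ 4 * ∫ r in ρ..R, r ^ (σ + 1) * G r ^ 2 := by
  have hpos : ∀ r ∈ Set.uIcc ρ R, 0 < r := fun r hr => by
    rw [Set.uIcc_of_le hR.le] at hr; exact hρ.trans_le hr.1
  have hFc : ContinuousOn F (Set.uIcc ρ R) := fun r hr =>
    (hF r (hpos r hr)).continuousAt.continuousWithinAt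
  have hGc : ContinuousOn G (Set.uIcc ρ R) := hG.mono hpos
  have hp : ∀ s : ℝ, ContinuousOn (fun r : ℝ => r ^ s) (Set.uIcc ρ R) := fun s r hr =>
    (Real.continuousAt_rpow_const r s (Or.inl (hpos r hr).ne')).continuousWithinAt
  have hd : ∀ r ∈ Set.uIcc ρ R, HasDerivAt (fun r => r ^ σ * F r ^ 2)
      (σ * (r ^ (σ - 1) * F r ^ 2) + 2 * (r ^ σ * (F r * G r))) r := fun r hr => by
    have h1 := (Real.hasDerivAt_rpow_const (p := σ) (Or.inl (hpos r hr).ne')).mul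
      ((hF r (hpos r hr)).pow 2)
    refine h1.congr_deriv ?_
    simp
    ring
  have hA : IntervalIntegrable (fun r => r ^ (σ - 1) * F r ^ 2) volume ρ R :=
    ((hp _).mul (hFc.pow 2)).intervalIntegrable
  have hB : IntervalIntegrable (fun r => r ^ σ * (F r * G r)) volume ρ R :=
    ((hp _).mul (hFc.mul hGc)).intervalIntegrable
  have hC : IntervalIntegrable (fun r => r ^ (σ + 1) * G r ^ 2) volume ρ R :=
    ((hp _).mul (hGc.pow 2)).intervalIntegrable
  have hI := intervalIntegral.integral_eq_sub_of_hasDerivAt hd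
    ((hA.const_mul σ).add (hB.const_mul 2))
  rw [intervalIntegral.integral_add (hA.const_mul σ) (hB.const_mul 2),
    intervalIntegral.integral_const_mul, intervalIntegral.integral_const_mul] at hI
  have hb : σ * (R ^ σ * F R ^ 2 - ρ ^ σ * F ρ ^ 2) ≤ 0 := by
    have h1 : 0 ≤ R ^ σ := Real.rpow_nonneg (hρ.trans hR).le _
    have h2 : 0 ≤ ρ ^ σ := Real.rpow_nonneg hρ.le _
    split_ifs at h0 with h
    · rw [h0]
      have : 0 ≤ σ * (ρ ^ σ * F ρ ^ 2) := by positivity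
      linarith
    · rw [h0]
      have : 0 ≤ (-σ) * (R ^ σ * F R ^ 2) := mul_nonneg (by linarith) (by positivity)
      linarith
  have hm : ∫ r in ρ..R, -(2 * σ) * (r ^ σ * (F r * G r)) ≤
      ∫ r in ρ..R, (σ ^ 2 / 2 * (r ^ (σ - 1) * F r ^ 2) + 2 * (r ^ (σ + 1) * G r ^ 2)) := by
    refine intervalIntegral.integral_mono_on hR.le (hB.const_mul _)
      ((hA.const_mul _).add (hC.const_mul _)) fun r hr => ?_
    have hr0 : 0 < r := hρ.trans_le hr.1
    have e1 : r ^ σ = r ^ (σ - 1) * r := by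
      rw [← Real.rpow_add_one hr0.ne', sub_add_cancel]
    have e2 : r ^ (σ + 1) = r ^ (σ - 1) * r ^ 2 := by
      rw [Real.rpow_add_one hr0.ne', e1]; ring
    rw [e1, e2]
    have : 0 ≤ r ^ (σ - 1) * (σ * F r + 2 * r * G r) ^ 2 :=
      mul_nonneg (Real.rpow_nonneg hr0.le _) (sq_nonneg _)
    linarith
  rw [intervalIntegral.integral_add (hA.const_mul _) (hC.const_mul _),
    intervalIntegral.integral_const_mul, intervalIntegral.integral_const_mul,
    intervalIntegral.integral_const_mul] at hm
  rw [← hI] at hb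
  linarith

/-- The profile `φ` on `(0, ∞)` solves the radial equation `φ'' + (N - 1) / r φ' = ψ` with flux
`P = r ^ (N - 1) φ'`, where `φ` vanishes at `b` and `P` vanishes at `a`. -/
structure IsRadialSolution (N : ℕ) (a b : ℝ) (ψ φ P : ℝ → ℝ) : Prop where
  continuousOn : ContinuousOn ψ (Set.Ioi 0)
  hasDerivAt_flux : ∀ r, 0 < r → HasDerivAt P (r ^ N / r * ψ r) r
  hasDerivAt : ∀ r, 0 < r → HasDerivAt φ (r / r ^ N * P r) r
  flux_eq_zero : P a = 0
  eq_zero : φ b = 0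

lemma exists_isRadialSolution (N : ℕ) {a b : ℝ} (ha : 0 < a) (hb : 0 < b) {ψ : ℝ → ℝ}
    (hψ : ContinuousOn ψ (Set.Ioi 0)) : ∃ φ P, IsRadialSolution N a b ψ φ P := by
  have key : ∀ c, 0 < c → ∀ f : ℝ → ℝ, ContinuousOn f (Set.Ioi 0) → ∀ r, 0 < r →
      HasDerivAt (fun r => ∫ s in c..r, f s) (f r) r := fun c hc f hf r hr =>
    intervalIntegral.integral_hasDerivAt_right
      (hf.mono fun s hs => (lt_min hc hr).trans_le hs.1).intervalIntegrable
      (hf.stronglyMeasurableAtFilter isOpen_Ioi r hr) (hf.continuousAt (Ioi_mem_nhds hr))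
  have h1 : ContinuousOn (fun r => r ^ N / r * ψ r) (Set.Ioi 0) :=
    ((continuousOn_id.pow N).div continuousOn_id fun r hr => (ne_of_gt hr)).mul hψ
  have hP := key a ha _ h1
  have h2 : ContinuousOn (fun r => r / r ^ N * ∫ s in a..r, s ^ N / s * ψ s) (Set.Ioi 0) :=
    (continuousOn_id.div (continuousOn_id.pow N) fun r hr => pow_ne_zero _ (ne_of_gt hr)).mul
      fun r hr => (hP r hr).continuousAt.continuousWithinAt
  exact ⟨_, _, hψ, hP, key b hb _ h2, by simp, by simp⟩

namespace IsRadialSolution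

variable {N : ℕ} {a b : ℝ} {ψ φ P ψ' φ' P' : ℝ → ℝ}

lemma add (h : IsRadialSolution N a b ψ φ P) (h' : IsRadialSolution N a b ψ' φ' P') :
    IsRadialSolution N a b (fun r => ψ r + ψ' r) (fun r => φ r + φ' r) (fun r => P r + P' r) where
  continuousOn := h.continuousOn.add h'.continuousOn
  hasDerivAt_flux r hr :=
    ((h.hasDerivAt_flux r hr).add (h'.hasDerivAt_flux r hr)).congr_deriv (by ring)
  hasDerivAt r hr := ((h.hasDerivAt r hr).add (h'.hasDerivAt r hr)).congr_deriv (by ring)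
  flux_eq_zero := by simp [h.flux_eq_zero, h'.flux_eq_zero]
  eq_zero := by simp [h.eq_zero, h'.eq_zero]

lemma const_mul (h : IsRadialSolution N a b ψ φ P) (c : ℝ) :
    IsRadialSolution N a b (fun r => c * ψ r) (fun r => c * φ r) (fun r => c * P r) where
  continuousOn := continuousOn_const.mul h.continuousOn
  hasDerivAt_flux r hr := ((h.hasDerivAt_flux r hr).const_mul c).congr_deriv (by ring)
  hasDerivAt r hr := ((h.hasDerivAt r hr).const_mul c).congr_deriv (by ring)
  flux_eq_zero := by simp [h.flux_eq_zero]
  eq_zero := by simp [h.eq_zero]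

lemma zero : IsRadialSolution N a b (fun _ => 0) (fun _ => 0) (fun _ => 0) where
  continuousOn := continuousOn_const
  hasDerivAt_flux r _ := (hasDerivAt_const r 0).congr_deriv (by ring)
  hasDerivAt r _ := (hasDerivAt_const r 0).congr_deriv (by ring)
  flux_eq_zero := rfl
  eq_zero := rfl

lemma continuousOn_sol (h : IsRadialSolution N a b ψ φ P) : ContinuousOn φ (Set.Ioi 0) :=
  fun r hr => (h.hasDerivAt r hr).continuousAt.continuousWithinAt

lemma continuousOn_flux (h : IsRadialSolution N a b ψ φ P) : ContinuousOn P (Set.Ioi 0) :=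
  fun r hr => (h.hasDerivAt_flux r hr).continuousAt.continuousWithinAt

lemma weighted_bound {σ τ : ℝ} (hρ : 0 < ρ) (hR : ρ < R) (hN : σ + τ + 2 * N = 4 + 2 * σ)
    (h : IsRadialSolution N (if 0 < τ then R else ρ) (if 0 < σ then R else ρ) ψ φ P) :
    (σ * τ) ^ 2 * ∫ r in ρ..R, r ^ (σ - 1) * φ r ^ 2 ≤
      16 * ∫ r in ρ..R, r ^ (σ + 3) * ψ r ^ 2 := by
  have h1 := integral_rpow_mul_sq_le hρ hR h.hasDerivAt
    ((continuousOn_id.div (continuousOn_id.pow N) fun r hr => pow_ne_zero _ (ne_of_gt hr)).mul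
      h.continuousOn_flux) h.eq_zero
  have h2 := integral_rpow_mul_sq_le hρ hR h.hasDerivAt_flux
    (((continuousOn_id.pow N).div continuousOn_id fun r hr => (ne_of_gt hr)).mul h.continuousOn)
    h.flux_eq_zero
  have e1 : ∫ r in ρ..R, r ^ (σ + 1) * (id r / id r ^ N * P r) ^ 2 =
      ∫ r in ρ..R, r ^ (τ - 1) * P r ^ 2 := by
    refine intervalIntegral.integral_congr fun r hr => ?_
    rw [Set.uIcc_of_le hR.le] at hr
    have hr0 : 0 < r := hρ.trans_le hr.1
    have : r ^ (σ + 1) = r ^ (τ - 1) * (r ^ N) ^ 2 / r ^ 2 := by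
      rw [← pow_mul, ← Real.rpow_natCast r (N * 2), ← Real.rpow_natCast r 2,
        ← Real.rpow_add hr0, ← Real.rpow_sub hr0]
      congr 1
      push_cast
      linarith
    simp only [id]
    rw [this]
    field_simp
  have e2 : ∫ r in ρ..R, r ^ (τ + 1) * (id r ^ N / id r * ψ r) ^ 2 =
      ∫ r in ρ..R, r ^ (σ + 3) * ψ r ^ 2 := by
    refine intervalIntegral.integral_congr fun r hr => ?_
    rw [Set.uIcc_of_le hR.le] at hr
    have hr0 : 0 < r := hρ.trans_le hr.1
    have : r ^ (σ + 3) = r ^ (τ + 1) * (r ^ N) ^ 2 / r ^ 2 := by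
      rw [← pow_mul, ← Real.rpow_natCast r (N * 2), ← Real.rpow_natCast r 2,
        ← Real.rpow_add hr0, ← Real.rpow_sub hr0]
      congr 1
      push_cast
      linarith
    simp only [id]
    rw [this]
    field_simp
  simp only [id] at e1 e2 h1 h2
  rw [e1] at h1
  rw [e2] at h2
  have h3 := mul_le_mul_of_nonneg_left h1 (sq_nonneg τ)
  calc _ = τ ^ 2 * (σ ^ 2 * ∫ r in ρ..R, r ^ (σ - 1) * φ r ^ 2) := by ring
    _ ≤ _ := by linarith

end IsRadialSolution

end WeightedHardy

section RadialTimesHarmonic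
open MvPolynomial

variable {n d : ℕ} {a b : ℝ} {ψ φ P : ℝ → ℝ}

lemma IsRadialSolution.contDiffAt {N : ℕ} (h : IsRadialSolution N a b ψ φ P) {r : ℝ} (hr : 0 < r) :
    ContDiffAt ℝ 2 φ r := by
  have hP : ContDiffOn ℝ 1 P (Set.Ioi 0) := by
    refine ((contDiffOn_succ_iff_deriv_of_isOpen (n := 0) isOpen_Ioi).2 ⟨fun s hs =>
      (h.hasDerivAt_flux s hs).differentiableAt.differentiableWithinAt, by simp, ?_⟩)
    refine contDiffOn_zero.2 (ContinuousOn.congr (f := fun r => r ^ N / r * ψ r) ?_ fun s hs =>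
      (h.hasDerivAt_flux s hs).deriv)
    exact ((continuousOn_id.pow N).div continuousOn_id fun r hr => (ne_of_gt hr)).mul h.continuousOn
  have hφ : ContDiffOn ℝ 2 φ (Set.Ioi 0) := by
    refine ((contDiffOn_succ_iff_deriv_of_isOpen (n := 1) isOpen_Ioi).2 ⟨fun s hs =>
      (h.hasDerivAt s hs).differentiableAt.differentiableWithinAt, by simp, ?_⟩)
    refine ContDiffOn.congr (f := fun r => r / r ^ N * P r) ?_ fun s hs => (h.hasDerivAt s hs).deriv
    exact ContDiffOn.mul (ContDiffOn.fun_div (f := fun r : ℝ => r) contDiffOn_id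
      (g := fun r => r ^ N) (contDiffOn_id.pow N) fun r hr => pow_ne_zero _ (ne_of_gt hr)) hP
  exact hφ.contDiffAt (Ioi_mem_nhds hr)

lemma IsRadialSolution.contDiffAt_mul_polyFun {N : ℕ} (h : IsRadialSolution N a b ψ φ P)
    (Y : MvPolynomial (Fin n) ℝ) {x : EuclideanSpace ℝ (Fin n)} (hx : x ≠ 0) :
    ContDiffAt ℝ 2 (fun y => φ ‖y‖ * polyFun Y y) x :=
  ((h.contDiffAt (norm_pos_iff.2 hx)).comp x (contDiffAt_norm ℝ hx)).mul
    (contDiff_polyFun Y).contDiffAt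

lemma IsRadialSolution.laplacian_mul_polyFun (h : IsRadialSolution (n + 2 * d) a b ψ φ P)
    {Y : MvPolynomial (Fin n) ℝ} (hY : Y.IsHomogeneous d) (hΔ : polyLap Y = 0)
    {x : EuclideanSpace ℝ (Fin n)} (hx : x ≠ 0) :
    ∑ i, partialD i (partialD i fun y => φ ‖y‖ * polyFun Y y) x = ψ ‖x‖ * polyFun Y x := by
  set N := n + 2 * d with hN
  set q : ℝ → ℝ := fun r => P r / r ^ N with hq
  have hYd : ∀ (p : MvPolynomial (Fin n) ℝ) y, DifferentiableAt ℝ (polyFun p) y := fun p y =>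
    (contDiff_polyFun p (k := 1)).differentiable one_ne_zero y
  have hnd : ∀ {f : ℝ → ℝ} {f' : ℝ} {y : EuclideanSpace ℝ (Fin n)}, y ≠ 0 →
      HasDerivAt f f' ‖y‖ → DifferentiableAt ℝ (fun y : EuclideanSpace ℝ (Fin n) => f ‖y‖) y :=
    fun hy hf => hf.differentiableAt.comp _
      ((contDiffAt_norm ℝ (n := 1) hy).differentiableAt one_ne_zero)
  have hcd : ∀ i : Fin n, DifferentiableAt ℝ (fun y : EuclideanSpace ℝ (Fin n) => y i) x :=
    fun i => (EuclideanSpace.proj (𝕜 := ℝ) i :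
      EuclideanSpace ℝ (Fin n) →L[ℝ] ℝ).differentiableAt
  have hφ : ∀ {y : EuclideanSpace ℝ (Fin n)}, y ≠ 0 → HasDerivAt φ (‖y‖ * q ‖y‖) ‖y‖ := fun hy =>
    (h.hasDerivAt _ (norm_pos_iff.2 hy)).congr_deriv (by simp only [hq]; ring)
  have hr : ‖x‖ ≠ 0 := norm_ne_zero_iff.2 hx
  have hqd : HasDerivAt q ((ψ ‖x‖ - N * q ‖x‖) / ‖x‖) ‖x‖ := by
    refine ((h.hasDerivAt_flux _ (norm_pos_iff.2 hx)).div (hasDerivAt_pow N ‖x‖)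
      (pow_ne_zero _ hr)).congr_deriv ?_
    have hNpow : (N : ℝ) * ‖x‖ ^ (N - 1) = N * ‖x‖ ^ N / ‖x‖ := by
      rcases Nat.eq_zero_or_pos N with h0 | h0
      · simp [h0]
      · obtain ⟨m, hm⟩ := Nat.exists_eq_succ_of_ne_zero h0.ne'
        rw [hm, pow_succ]
        field_simp
        simp
    simp only [hq]
    rw [hNpow]
    field_simp
  have h1 : ∀ i, ∀ y : EuclideanSpace ℝ (Fin n), y ≠ 0 →
      partialD i (fun y => φ ‖y‖ * polyFun Y y) y =
        q ‖y‖ * (y i * polyFun Y y) + φ ‖y‖ * polyFun (pderiv i Y) y := fun i y hy => by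
    rw [partialD_mul (hnd hy (hφ hy)) (hYd Y y), partialD_radial hy (hφ hy), partialD_polyFun]
    have : ‖y‖ ≠ 0 := norm_ne_zero_iff.2 hy
    field_simp
  have h2 : ∀ i, partialD i (partialD i fun y => φ ‖y‖ * polyFun Y y) x =
      (ψ ‖x‖ - N * q ‖x‖) / ‖x‖ ^ 2 * polyFun Y x * (x i * x i) + q ‖x‖ * polyFun Y x
        + 2 * q ‖x‖ * (x i * partialD i (polyFun Y) x)
        + φ ‖x‖ * partialD i (partialD i (polyFun Y)) x := fun i => by
    have he : partialD i (fun y => φ ‖y‖ * polyFun Y y) =ᶠ[nhds x] fun y =>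
        q ‖y‖ * (y i * polyFun Y y) + φ ‖y‖ * polyFun (pderiv i Y) y := by
      filter_upwards [isOpen_ne.mem_nhds hx] with y hy using h1 i y hy
    have hYi : partialD i (polyFun Y) = polyFun (pderiv i Y) := partialD_polyFun Y i
    rw [partialD_congr he, partialD_add ((hnd hx hqd).fun_mul ((hcd i).fun_mul (hYd Y x)))
      ((hnd hx (hφ hx)).fun_mul (hYd _ x)), partialD_mul (hnd hx hqd) ((hcd i).fun_mul (hYd Y x)),
      partialD_mul (hcd i) (hYd Y x), partialD_mul (hnd hx (hφ hx)) (hYd _ x),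
      partialD_radial hx hqd, partialD_radial hx (hφ hx), partialD_coord, hYi]
    simp only [if_true]
    field_simp
    ring
  simp only [h2, Finset.sum_add_distrib, ← Finset.mul_sum, sum_sq_eq_norm_sq,
    sum_coord_mul_partialD_polyFun hY, sum_partialD_partialD_polyFun, hΔ]
  simp [polyFun, hN]
  field_simp
  ring

end RadialTimesHarmonic

section Modes
open MvPolynomial

variable {n d e : ℕ} {ρ R a b : ℝ} {f g v g' v' : EuclideanSpace ℝ (Fin n) → ℝ}

/-- The closed annulus of radii `ρ` and `R`. -/
def annulus (n : ℕ) (ρ R : ℝ) : Set (EuclideanSpace ℝ (Fin n)) := {x | ‖x‖ ∈ Set.Icc ρ R}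

lemma isCompact_annulus (n : ℕ) (ρ R : ℝ) : IsCompact (annulus n ρ R) := by
  refine (isCompact_closedBall (0 : EuclideanSpace ℝ (Fin n)) R).of_isClosed_subset
    (isClosed_Icc.preimage continuous_norm) fun x hx => ?_
  simpa using hx.2

lemma measurableSet_annulus : MeasurableSet (annulus n ρ R) :=
  (isCompact_annulus n ρ R).isClosed.measurableSet

lemma ne_zero_of_mem_annulus (hρ : 0 < ρ) {x : EuclideanSpace ℝ (Fin n)}
    (hx : x ∈ annulus n ρ R) : x ≠ 0 :=
  norm_pos_iff.1 (hρ.trans_le hx.1)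

lemma continuousOn_norm_rpow (s : ℝ) :
    ContinuousOn (fun x : EuclideanSpace ℝ (Fin n) => ‖x‖ ^ s) {0}ᶜ :=
  continuous_norm.continuousOn.rpow_const fun _ hx => Or.inl (norm_ne_zero_iff.2 hx)

lemma integrableOn_annulus (hρ : 0 < ρ) (hf : ContinuousOn f {0}ᶜ) :
    IntegrableOn f (annulus n ρ R) :=
  (hf.mono fun _ hx => ne_zero_of_mem_annulus hρ hx).integrableOn_compact (isCompact_annulus n ρ R)

lemma integrableOn_annulus_rpow_mul (hρ : 0 < ρ) (s : ℝ) (hf : ContinuousOn f {0}ᶜ) :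
    IntegrableOn (fun x => ‖x‖ ^ s * f x) (annulus n ρ R) :=
  integrableOn_annulus hρ ((continuousOn_norm_rpow s).mul hf)

/-- Sums of products of radial functions with harmonic homogeneous polynomials of degree `d`. -/
noncomputable def radialHarmonic (n d : ℕ) : Submodule ℝ (EuclideanSpace ℝ (Fin n) → ℝ) :=
  Submodule.span ℝ {f | ∃ (φ : ℝ → ℝ) (Y : MvPolynomial (Fin n) ℝ), ContinuousOn φ (Set.Ioi 0) ∧
    Y.IsHomogeneous d ∧ polyLap Y = 0 ∧ f = fun x => φ ‖x‖ * polyFun Y x}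

lemma continuousOn_of_mem_radialHarmonic (hf : f ∈ radialHarmonic n d) :
    ContinuousOn f {0}ᶜ := by
  induction hf using Submodule.span_induction with
  | mem f h =>
    obtain ⟨φ, Y, hφ, -, -, rfl⟩ := h
    exact (hφ.comp continuous_norm.continuousOn fun x hx => norm_pos_iff.2 hx).mul
      (contDiff_polyFun Y (k := 0)).continuous.continuousOn
  | zero => exact continuousOn_const
  | add f g _ _ hf hg => exact hf.add hg
  | smul c f _ hf => exact continuousOn_const.mul hf

lemma integral_annulus_mul_eq_zero [NeZero n] (hρ : 0 < ρ) (hde : d ≠ e) (s : ℝ)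
    (hf : f ∈ radialHarmonic n d) (hg : g ∈ radialHarmonic n e) :
    ∫ x in annulus n ρ R, ‖x‖ ^ s * (f x * g x) = 0 := by
  have hfg : ∀ {f g : EuclideanSpace ℝ (Fin n) → ℝ}, f ∈ radialHarmonic n d →
      g ∈ radialHarmonic n e → IntegrableOn (fun x => ‖x‖ ^ s * (f x * g x)) (annulus n ρ R) :=
    fun hf hg => integrableOn_annulus_rpow_mul hρ s
      ((continuousOn_of_mem_radialHarmonic hf).mul (continuousOn_of_mem_radialHarmonic hg))
  induction hf using Submodule.span_induction with
  | zero => simp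
  | smul c f hf h =>
    have : ∀ x, ‖x‖ ^ s * ((c • f) x * g x) = c * (‖x‖ ^ s * (f x * g x)) := fun x => by
      simp only [Pi.smul_apply, smul_eq_mul]; ring
    simp only [this, integral_const_mul, h, mul_zero]
  | add f₁ f₂ h₁ h₂ ih₁ ih₂ =>
    have : ∀ x, ‖x‖ ^ s * ((f₁ + f₂) x * g x) =
        ‖x‖ ^ s * (f₁ x * g x) + ‖x‖ ^ s * (f₂ x * g x) := fun x => by
      simp only [Pi.add_apply]; ring
    simp only [this]
    rw [integral_add (hfg h₁ hg) (hfg h₂ hg), ih₁, ih₂, add_zero]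
  | mem f h =>
    have hf : f ∈ radialHarmonic n d := Submodule.subset_span h
    induction hg using Submodule.span_induction with
    | zero => simp
    | smul c g hg h =>
      have : ∀ x, ‖x‖ ^ s * (f x * (c • g) x) = c * (‖x‖ ^ s * (f x * g x)) := fun x => by
        simp only [Pi.smul_apply, smul_eq_mul]; ring
      simp only [this, integral_const_mul, h, mul_zero]
    | add g₁ g₂ h₁ h₂ ih₁ ih₂ =>
      have : ∀ x, ‖x‖ ^ s * (f x * (g₁ + g₂) x) =
          ‖x‖ ^ s * (f x * g₁ x) + ‖x‖ ^ s * (f x * g₂ x) := fun x => by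
        simp only [Pi.add_apply]; ring
      simp only [this]
      rw [integral_add (hfg hf h₁) (hfg hf h₂), ih₁, ih₂, add_zero]
    | mem g hg =>
      obtain ⟨φ, Y, -, hY, hΔY, rfl⟩ := h
      obtain ⟨χ, Z, -, hZ, hΔZ, rfl⟩ := hg
      rw [← integral_indicator measurableSet_annulus,
        ← integral_norm_mul_polyFun_mul_polyFun_eq_zero hde hY hΔY hZ hΔZ
          ((Set.Icc ρ R).indicator fun r => r ^ s * (φ r * χ r))]
      refine integral_congr_ae (Filter.Eventually.of_forall fun x => ?_)
      by_cases hx : ‖x‖ ∈ Set.Icc ρ R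
      · rw [Set.indicator_of_mem (show x ∈ annulus n ρ R from hx)]
        simp only [Set.indicator_of_mem hx]
        ring
      · rw [Set.indicator_of_notMem (show x ∉ annulus n ρ R from hx)]
        simp only [Set.indicator_of_notMem hx]
        ring

/-- `v` solves `Δv = g` off the origin, both being of angular degree `d`, and along each ray the
radial equation holds with the boundary conditions of `IsRadialSolution`. -/
structure IsModeSolution (d : ℕ) (a b : ℝ) (g v : EuclideanSpace ℝ (Fin n) → ℝ) : Prop where
  source_mem : g ∈ radialHarmonic n d
  mem : v ∈ radialHarmonic n d
  contDiffAt : ∀ x, x ≠ 0 → ContDiffAt ℝ 2 v x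
  laplacian : ∀ x, x ≠ 0 → ∑ i, partialD i (partialD i v) x = g x
  ray : ∀ θ, ‖θ‖ = 1 → ∃ ψ φ P, IsRadialSolution (n + 2 * d) a b ψ φ P ∧
    ∀ r, 0 < r → g (r • θ) = r ^ d * ψ r ∧ v (r • θ) = r ^ d * φ r

lemma sum_partialD_partialD_add {x : EuclideanSpace ℝ (Fin n)} (hf : ContDiffAt ℝ 2 f x)
    (hg : ContDiffAt ℝ 2 g x) : ∑ i, partialD i (partialD i fun y => f y + g y) x =
      ∑ i, partialD i (partialD i f) x + ∑ i, partialD i (partialD i g) x := by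
  rw [← Finset.sum_add_distrib]
  refine Finset.sum_congr rfl fun i _ => ?_
  have h : ∀ {f : EuclideanSpace ℝ (Fin n) → ℝ}, ContDiffAt ℝ 2 f x →
      ∀ᶠ y in nhds x, DifferentiableAt ℝ f y := fun hf =>
    (hf.eventually (by simp)).mono fun y hy => hy.differentiableAt two_ne_zero
  have he : partialD i (fun y => f y + g y) =ᶠ[nhds x] fun y => partialD i f y + partialD i g y := by
    filter_upwards [h hf, h hg] with y h₁ h₂ using partialD_add h₁ h₂
  rw [partialD_congr he]
  exact partialD_add ((contDiffAt_partialD (m := 1) hf (by norm_num)).differentiableAt one_ne_zero)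
    ((contDiffAt_partialD (m := 1) hg (by norm_num)).differentiableAt one_ne_zero)

lemma partialD_const_mul (c : ℝ) (f : EuclideanSpace ℝ (Fin n) → ℝ) (i : Fin n) :
    partialD i (fun y => c * f y) = fun y => c * partialD i f y := by
  ext x
  simp only [partialD]
  rw [show (fun y => c * f y) = c • f from rfl, fderiv_const_smul_field]
  simp

namespace IsModeSolution

lemma zero : IsModeSolution (n := n) d a b (fun _ => 0) (fun _ => 0) where
  source_mem := (radialHarmonic n d).zero_mem
  mem := (radialHarmonic n d).zero_mem
  contDiffAt _ _ := contDiffAt_const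
  laplacian x _ := by
    have hz : ∀ i : Fin n, partialD i (fun _ => (0 : ℝ)) = fun _ => 0 := fun i => by
      ext; simp [partialD]
    simp [hz]
  ray θ _ := ⟨_, _, _, IsRadialSolution.zero, by simp⟩

lemma add (h : IsModeSolution d a b g v) (h' : IsModeSolution d a b g' v') :
    IsModeSolution d a b (fun x => g x + g' x) (fun x => v x + v' x) where
  source_mem := (radialHarmonic n d).add_mem h.source_mem h'.source_mem
  mem := (radialHarmonic n d).add_mem h.mem h'.mem
  contDiffAt x hx := (h.contDiffAt x hx).add (h'.contDiffAt x hx)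
  laplacian x hx := by
    rw [sum_partialD_partialD_add (h.contDiffAt x hx) (h'.contDiffAt x hx), h.laplacian x hx,
      h'.laplacian x hx]
  ray θ hθ := by
    obtain ⟨ψ, φ, P, h₁, h₂⟩ := h.ray θ hθ
    obtain ⟨ψ', φ', P', h₁', h₂'⟩ := h'.ray θ hθ
    refine ⟨_, _, _, h₁.add h₁', fun r hr => ?_⟩
    simp only [h₂ r hr, h₂' r hr]
    constructor <;> ring

lemma const_mul (h : IsModeSolution d a b g v) (c : ℝ) :
    IsModeSolution d a b (fun x => c * g x) (fun x => c * v x) where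
  source_mem := (radialHarmonic n d).smul_mem c h.source_mem
  mem := (radialHarmonic n d).smul_mem c h.mem
  contDiffAt x hx := contDiffAt_const.mul (h.contDiffAt x hx)
  laplacian x hx := by
    simp only [partialD_const_mul, ← Finset.mul_sum, h.laplacian x hx]
  ray θ hθ := by
    obtain ⟨ψ, φ, P, h₁, h₂⟩ := h.ray θ hθ
    refine ⟨_, _, _, h₁.const_mul c, fun r hr => ?_⟩
    simp only [h₂ r hr]
    constructor <;> ring

lemma integral_le [NeZero n] {α σ τ : ℝ} (hρ : 0 < ρ) (hR : ρ < R)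
    (hσ : σ = n - α + 2 * d) (hτ : τ = 4 - n - α - 2 * d)
    (h : IsModeSolution d (if 0 < τ then R else ρ) (if 0 < σ then R else ρ) g v) :
    (σ * τ) ^ 2 * ∫ x in annulus n ρ R, ‖x‖ ^ (-α) * v x ^ 2 ≤
      16 * ∫ x in annulus n ρ R, ‖x‖ ^ (4 - α) * g x ^ 2 := by
  have hg := continuousOn_of_mem_radialHarmonic h.source_mem
  have hv := continuousOn_of_mem_radialHarmonic h.mem
  rw [← sub_nonneg, ← integral_const_mul, ← integral_const_mul, ← integral_sub
    ((integrableOn_annulus_rpow_mul (f := fun x => g x ^ 2) hρ _ (hg.pow 2)).const_mul _)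
    ((integrableOn_annulus_rpow_mul (f := fun x => v x ^ 2) hρ _ (hv.pow 2)).const_mul _),
    ← integral_indicator measurableSet_annulus]
  refine integral_nonneg_of_forall_ray _ _ fun θ hθ => ?_
  obtain ⟨ψ, φ, P, hs, hray⟩ := h.ray θ hθ
  have hn : 1 ≤ n := NeZero.one_le
  have hw := hs.weighted_bound hρ hR (by rw [hσ, hτ]; push_cast; ring)
  have hpos : ∀ r ∈ Set.uIcc ρ R, r ∈ Set.Ioi (0 : ℝ) := fun r hr => by
    rw [Set.uIcc_of_le hR.le] at hr; exact hρ.trans_le hr.1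
  have hp : ∀ (s : ℝ) {F : ℝ → ℝ}, ContinuousOn F (Set.Ioi 0) →
      IntervalIntegrable (fun r : ℝ => r ^ s * F r ^ 2) volume ρ R := fun s F hF =>
    ContinuousOn.intervalIntegrable (ContinuousOn.mul (fun r hr =>
      (Real.continuousAt_rpow_const r s (Or.inl (ne_of_gt (hpos r hr)))).continuousWithinAt)
      ((hF.mono hpos).pow 2))
  rw [← sub_nonneg, ← intervalIntegral.integral_const_mul, ← intervalIntegral.integral_const_mul,
    ← intervalIntegral.integral_sub
      ((hp _ hs.continuousOn).const_mul _) ((hp _ hs.continuousOn_sol).const_mul _),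
    intervalIntegral.integral_of_le hR.le, ← integral_Icc_eq_integral_Ioc] at hw
  refine hw.trans_eq ?_
  rw [setIntegral_eq_of_subset_of_forall_sdiff_eq_zero measurableSet_Ioi
    (show Set.Icc ρ R ⊆ Set.Ioi 0 from fun r hr => hρ.trans_le hr.1)]
  · refine setIntegral_congr_fun measurableSet_Icc fun r hr => ?_
    have hr0 : 0 < r := hρ.trans_le hr.1
    have hnorm : ‖r • θ‖ = r := by rw [norm_smul, hθ, mul_one, Real.norm_of_nonneg hr0.le]
    have hmem : r • θ ∈ annulus n ρ R := by
      change ‖r • θ‖ ∈ Set.Icc ρ R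
      rwa [hnorm]
    simp only [Set.indicator_of_mem hmem, hnorm, (hray r hr0).1, (hray r hr0).2,
      finrank_euclideanSpace_fin]
    have e1 : r ^ (σ + 3) = r ^ (n - 1) * r ^ (4 - α) * (r ^ d) ^ 2 := by
      rw [← pow_mul, ← Real.rpow_natCast r (n - 1), ← Real.rpow_natCast r (d * 2),
        ← Real.rpow_add hr0, ← Real.rpow_add hr0, hσ]
      congr 1
      push_cast [hn]
      ring
    have e2 : r ^ (σ - 1) = r ^ (n - 1) * r ^ (-α) * (r ^ d) ^ 2 := by
      rw [← pow_mul, ← Real.rpow_natCast r (n - 1), ← Real.rpow_natCast r (d * 2),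
        ← Real.rpow_add hr0, ← Real.rpow_add hr0, hσ]
      congr 1
      push_cast [hn]
      ring
    rw [e1, e2]
    ring
  · intro r hr
    have hnorm : ‖r • θ‖ = r := by
      rw [norm_smul, hθ, mul_one, Real.norm_of_nonneg (le_of_lt hr.1)]
    have hmem : r • θ ∉ annulus n ρ R := fun h => hr.2 (by
      have h' : ‖r • θ‖ ∈ Set.Icc ρ R := h
      rwa [hnorm] at h')
    rw [Set.indicator_of_notMem hmem, mul_zero]

end IsModeSolution

/-- Sums of products of even powers of the norm with harmonic homogeneous polynomials of
degree `d`. -/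
noncomputable def modeSource (n d : ℕ) : Submodule ℝ (EuclideanSpace ℝ (Fin n) → ℝ) :=
  Submodule.span ℝ {f | ∃ (j : ℕ) (Y : MvPolynomial (Fin n) ℝ), Y.IsHomogeneous d ∧
    polyLap Y = 0 ∧ f = fun x => ‖x‖ ^ (2 * j) * polyFun Y x}

lemma exists_isModeSolution (ha : 0 < a) (hb : 0 < b) (hg : g ∈ modeSource n d) :
    ∃ v, IsModeSolution d a b g v := by
  induction hg using Submodule.span_induction with
  | zero => exact ⟨_, IsModeSolution.zero⟩
  | add g g' _ _ h h' =>
    obtain ⟨v, hv⟩ := h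
    obtain ⟨v', hv'⟩ := h'
    exact ⟨_, hv.add hv'⟩
  | smul c g _ h =>
    obtain ⟨v, hv⟩ := h
    exact ⟨_, hv.const_mul c⟩
  | mem g h =>
    obtain ⟨j, Y, hY, hΔ, rfl⟩ := h
    obtain ⟨φ, P, h⟩ := exists_isRadialSolution (n + 2 * d) ha hb
      (ψ := fun r => r ^ (2 * j)) (by fun_prop)
    refine ⟨fun x => φ ‖x‖ * polyFun Y x, ?_, ?_, fun x hx => h.contDiffAt_mul_polyFun Y hx,
      fun x hx => h.laplacian_mul_polyFun hY hΔ hx, fun θ hθ =>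
        ⟨_, _, _, h.const_mul (polyFun Y θ), fun r hr => ?_⟩⟩
    · exact Submodule.subset_span ⟨_, Y, h.continuousOn, hY, hΔ, rfl⟩
    · exact Submodule.subset_span ⟨_, Y, h.continuousOn_sol, hY, hΔ, rfl⟩
    · rw [norm_smul, hθ, mul_one, Real.norm_of_nonneg hr.le, polyFun_smul hY]
      constructor <;> ring

lemma polyFun_mem_iSup_modeSource (hn : n ≠ 0) (p : MvPolynomial (Fin n) ℝ) :
    polyFun p ∈ ⨆ d, modeSource n d := by
  have hadd : ∀ p q : MvPolynomial (Fin n) ℝ, polyFun (p + q) = polyFun p + polyFun q :=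
    fun p q => by ext; simp [polyFun]
  have hsmul : ∀ (c : ℝ) (p : MvPolynomial (Fin n) ℝ), polyFun (c • p) = c • polyFun p :=
    fun c p => by ext; simp [polyFun, smul_eval]
  let T : MvPolynomial (Fin n) ℝ →ₗ[ℝ] (EuclideanSpace ℝ (Fin n) → ℝ) :=
    { toFun := polyFun, map_add' := hadd, map_smul' := hsmul }
  have hk : ∀ k, harmonicSpan n k ≤ (⨆ d, modeSource n d).comap T := by
    intro k
    refine Submodule.span_le.2 ?_
    rintro _ ⟨j, d, Y, hY, hΔ, -, rfl⟩
    refine Submodule.mem_iSup_of_mem d (Submodule.subset_span ⟨j, Y, hY, hΔ, ?_⟩)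
    ext x
    change polyFun _ x = _
    simp only [polyFun, normSqPoly, map_mul, map_pow, map_sum, eval_X, pow_mul,
      ← sum_sq_eq_norm_sq x, sq]
  rw [← sum_homogeneousComponent p]
  change T _ ∈ _
  rw [map_sum]
  exact Submodule.sum_mem _ fun k _ => hk k
    (mem_harmonicSpan_of_isHomogeneous hn k _ (homogeneousComponent_isHomogeneous k p))

end Modes

section Duality
open MvPolynomial

variable {n : ℕ} {ρ R : ℝ}

lemma exists_pos_forall_le_sq (hn : 2 ≤ n) {γ : ℝ}
    (h : ∀ k : ℕ, γ + (k : ℝ) * ((n : ℝ) - 2 + (k : ℝ)) ≠ 0) :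
    ∃ δ : ℝ, 0 < δ ∧ ∀ k : ℕ, δ ≤ (γ + (k : ℝ) * ((n : ℝ) - 2 + (k : ℝ))) ^ 2 := by
  obtain ⟨K, hK⟩ := exists_nat_ge (1 + |γ|)
  obtain ⟨m, -, hm⟩ := Finset.exists_min_image (Finset.range (K + 1))
    (fun k : ℕ => (γ + (k : ℝ) * ((n : ℝ) - 2 + (k : ℝ))) ^ 2) ⟨0, by simp⟩
  refine ⟨min 1 ((γ + (m : ℝ) * ((n : ℝ) - 2 + (m : ℝ))) ^ 2),
    lt_min one_pos (sq_pos_of_ne_zero (h m)), fun k => ?_⟩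
  rcases lt_or_ge k (K + 1) with hk | hk
  · exact (min_le_right _ _).trans (hm k (Finset.mem_range.2 hk))
  · refine (min_le_left _ _).trans ?_
    have h1 : (K : ℝ) + 1 ≤ k := by exact_mod_cast hk
    have h2 : (2 : ℝ) ≤ n := by exact_mod_cast hn
    have h3 := neg_abs_le γ
    have h4 : 0 ≤ |γ| := abs_nonneg γ
    have h5 : (k : ℝ) ≤ (k : ℝ) * ((n : ℝ) - 2 + (k : ℝ)) :=
      le_mul_of_one_le_right (by linarith) (by linarith)
    have h6 : 1 ≤ γ + (k : ℝ) * ((n : ℝ) - 2 + (k : ℝ)) := by linarith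
    nlinarith

lemma integral_annulus_sum_sq [NeZero n] (hρ : 0 < ρ) (t : ℝ) (s : Finset ℕ)
    {f : ℕ → EuclideanSpace ℝ (Fin n) → ℝ} (hf : ∀ d, f d ∈ radialHarmonic n d) :
    ∫ x in annulus n ρ R, ‖x‖ ^ t * (∑ d ∈ s, f d x) ^ 2 =
      ∑ d ∈ s, ∫ x in annulus n ρ R, ‖x‖ ^ t * f d x ^ 2 := by
  have hfg : ∀ d e, IntegrableOn (fun x => ‖x‖ ^ t * (f d x * f e x)) (annulus n ρ R) :=
    fun d e => integrableOn_annulus_rpow_mul hρ t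
      ((continuousOn_of_mem_radialHarmonic (hf d)).mul (continuousOn_of_mem_radialHarmonic (hf e)))
  have hsq : ∀ x, ‖x‖ ^ t * (∑ d ∈ s, f d x) ^ 2 =
      ∑ d ∈ s, ∑ e ∈ s, ‖x‖ ^ t * (f d x * f e x) := fun x => by
    rw [sq, Finset.sum_mul_sum]
    simp only [Finset.mul_sum]
  simp only [hsq]
  rw [integral_finsetSum _ fun d _ => integrable_finsetSum _ fun e _ => hfg d e]
  refine Finset.sum_congr rfl fun d hd => ?_
  rw [integral_finsetSum _ fun e _ => hfg d e]
  simp only [sq]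
  exact Finset.sum_eq_single_of_mem d hd fun e _ hed =>
    integral_annulus_mul_eq_zero hρ hed.symm t (hf d) (hf e)

lemma sum_partialD_partialD_sum {x : EuclideanSpace ℝ (Fin n)} (s : Finset ℕ)
    {v : ℕ → EuclideanSpace ℝ (Fin n) → ℝ} (hv : ∀ d, ContDiffAt ℝ 2 (v d) x) :
    ∑ i, partialD i (partialD i fun y => ∑ d ∈ s, v d y) x =
      ∑ d ∈ s, ∑ i, partialD i (partialD i (v d)) x := by
  classical
  induction s using Finset.induction_on with
  | empty =>
    have hz : ∀ i : Fin n, partialD i (fun _ => (0 : ℝ)) = fun _ => 0 := fun i => by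
      ext; simp [partialD]
    simp [hz]
  | insert d s hd ih =>
    simp only [Finset.sum_insert hd]
    rw [sum_partialD_partialD_add (hv d) (ContDiffAt.sum fun e _ => hv e), ih]

/-- Solvability of `Δv = p` on an annulus with a weighted estimate, for polynomial `p`. -/
lemma exists_solution_polyFun [NeZero n] {α γ δ : ℝ}
    (hγ : γ = ((n : ℝ) - 4 + α) * ((n : ℝ) - α) / 4)
    (hδ : ∀ k : ℕ, δ ≤ (γ + (k : ℝ) * ((n : ℝ) - 2 + (k : ℝ))) ^ 2) (hρ : 0 < ρ) (hR : ρ < R)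
    (p : MvPolynomial (Fin n) ℝ) :
    ∃ v : EuclideanSpace ℝ (Fin n) → ℝ, (∀ x, x ≠ 0 → ContDiffAt ℝ 2 v x) ∧
      (∀ x, x ≠ 0 → ∑ i, partialD i (partialD i v) x = polyFun p x) ∧
      δ * ∫ x in annulus n ρ R, ‖x‖ ^ (-α) * v x ^ 2 ≤
        ∫ x in annulus n ρ R, ‖x‖ ^ (4 - α) * polyFun p x ^ 2 := by
  classical
  obtain ⟨f, hf, hsum⟩ := (Submodule.mem_iSup_iff_exists_finsupp _ _).1
    (polyFun_mem_iSup_modeSource (NeZero.ne n) p)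
  have hsol := fun d : ℕ => exists_isModeSolution
    (a := if 0 < 4 - (n : ℝ) - α - 2 * d then R else ρ)
    (b := if 0 < (n : ℝ) - α + 2 * d then R else ρ)
    (by split_ifs <;> linarith) (by split_ifs <;> linarith) (hf d)
  choose v hv using hsol
  have hg : polyFun p = fun x => ∑ d ∈ f.support, f d x := by
    rw [← hsum]
    ext x
    simp [Finsupp.sum]
  refine ⟨fun x => ∑ d ∈ f.support, v d x,
    fun x hx => ContDiffAt.sum fun d _ => (hv d).contDiffAt x hx, fun x hx => ?_, ?_⟩
  · rw [sum_partialD_partialD_sum _ fun d => (hv d).contDiffAt x hx, hg]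
    exact Finset.sum_congr rfl fun d _ => (hv d).laplacian x hx
  · rw [integral_annulus_sum_sq hρ _ _ fun d => (hv d).mem, hg,
      integral_annulus_sum_sq hρ _ _ fun d => (hv d).source_mem, Finset.mul_sum]
    refine Finset.sum_le_sum fun d _ => ?_
    have h1 := (hv d).integral_le hρ hR rfl rfl
    have h2 : 0 ≤ ∫ x in annulus n ρ R, ‖x‖ ^ (-α) * v d x ^ 2 :=
      integral_nonneg fun x => by positivity
    have h3 := mul_le_mul_of_nonneg_right (hδ d) h2
    have h4 : (((n : ℝ) - α + 2 * d) * (4 - (n : ℝ) - α - 2 * d)) ^ 2 =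
        16 * (γ + (d : ℝ) * ((n : ℝ) - 2 + (d : ℝ))) ^ 2 := by
      rw [hγ]; ring
    rw [h4] at h1
    linarith

lemma exists_polyFun_near {K : Set (EuclideanSpace ℝ (Fin n))} (hK : IsCompact K)
    {h : EuclideanSpace ℝ (Fin n) → ℝ} (hh : ContinuousOn h K) {ε : ℝ} (hε : 0 < ε) :
    ∃ p : MvPolynomial (Fin n) ℝ, ∀ x ∈ K, |polyFun p x - h x| < ε := by
  have := isCompact_iff_compactSpace.1 hK
  let c : Fin n → C(K, ℝ) := fun i => ⟨fun x => (x : EuclideanSpace ℝ (Fin n)) i, by fun_prop⟩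
  have hc : ∀ (p : MvPolynomial (Fin n) ℝ) (x : K), aeval c p x = polyFun p x := by
    intro p x
    induction p using MvPolynomial.induction_on with
    | C a => simp [polyFun]
    | add p q hp hq => simp_all [polyFun]
    | mul_X p i hp => simp_all [polyFun, c]
  have hsep : (aeval (R := ℝ) c).range.SeparatesPoints := by
    intro x y hxy
    obtain ⟨i, hi⟩ : ∃ i, (x : EuclideanSpace ℝ (Fin n)) i ≠ (y : EuclideanSpace ℝ (Fin n)) i := by
      by_contra! hall
      exact hxy (Subtype.ext (PiLp.ext hall))
    exact ⟨_, ⟨aeval c (X i), ⟨X i, rfl⟩, rfl⟩, by simpa [c] using hi⟩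
  obtain ⟨⟨_, p, rfl⟩, hp⟩ := ContinuousMap.exists_mem_subalgebra_near_continuous_of_separatesPoints
    _ hsep (fun x : K => h x) hh.domRestrict ε hε
  refine ⟨p, fun x hx => ?_⟩
  have := hp ⟨x, hx⟩
  simpa [hc, Real.norm_eq_abs] using this

lemma lap_eq_zero_of_notMem {u : EuclideanSpace ℝ (Fin n) → ℝ} (hu : ContDiff ℝ 2 u)
    {x : EuclideanSpace ℝ (Fin n)} (hx : x ∉ tsupport u) : lap u x = 0 := by
  rw [lap_eq_sum_partialD hu]
  exact Finset.sum_eq_zero fun i _ => image_eq_zero_of_notMem_tsupport fun h =>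
    hx (tsupport_partialD_subset (tsupport_partialD_subset h))

lemma continuous_lap {u : EuclideanSpace ℝ (Fin n) → ℝ} (hu : ContDiff ℝ 2 u) :
    Continuous (lap u) := by
  rw [funext (lap_eq_sum_partialD hu)]
  refine continuous_finsetSum _ fun i _ => continuous_iff_continuousAt.2 fun x => ?_
  exact (contDiffAt_partialD (m := 0) (contDiffAt_partialD (m := 1) hu.contDiffAt
    (by norm_num)) (by norm_num)).continuousAt

/-- A weighted Rellich inequality. -/
lemma rellich [NeZero n] {α γ δ : ℝ} (hγ : γ = ((n : ℝ) - 4 + α) * ((n : ℝ) - α) / 4)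
    (hδ0 : 0 < δ) (hδ : ∀ k : ℕ, δ ≤ (γ + (k : ℝ) * ((n : ℝ) - 2 + (k : ℝ))) ^ 2)
    {u : EuclideanSpace ℝ (Fin n) → ℝ} (hu : ContDiff ℝ 2 u) (hc : HasCompactSupport u)
    (h0 : (0 : EuclideanSpace ℝ (Fin n)) ∉ tsupport u) :
    δ * ∫ x, ‖x‖ ^ (α - 4) * u x ^ 2 ≤ ∫ x, ‖x‖ ^ α * lap u x ^ 2 := by
  obtain ⟨ρ, R, hρ, hR, hA⟩ : ∃ ρ R : ℝ, 0 < ρ ∧ ρ < R ∧ tsupport u ⊆ annulus n ρ R := by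
    obtain ⟨ρ, hρ, hb⟩ := Metric.isOpen_iff.1 (isClosed_tsupport u).isOpen_compl 0 h0
    obtain ⟨R, hR⟩ := hc.isCompact.isBounded.subset_closedBall 0
    refine ⟨ρ, max R (ρ + 1), hρ, lt_max_of_lt_right (by linarith), fun x hx => ⟨?_, ?_⟩⟩
    · by_contra! hlt
      exact hb (by simpa using hlt) hx
    · exact (by simpa using hR hx : ‖x‖ ≤ R).trans (le_max_left _ _)
  have hne : ∀ x ∈ annulus n ρ R, x ≠ 0 := fun x hx => ne_zero_of_mem_annulus hρ hx
  have hu0 : ∀ x, x ∉ annulus n ρ R → u x = 0 := fun x hx =>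
    image_eq_zero_of_notMem_tsupport fun h => hx (hA h)
  have hl0 : ∀ x, x ∉ annulus n ρ R → lap u x = 0 := fun x hx =>
    lap_eq_zero_of_notMem hu fun h => hx (hA h)
  have huc : ContinuousOn u {0}ᶜ := hu.continuous.continuousOn
  have hlc : ContinuousOn (lap u) {0}ᶜ := (continuous_lap hu).continuousOn
  rw [← setIntegral_eq_integral_of_forall_compl_eq_zero (s := annulus n ρ R)
      (f := fun x => ‖x‖ ^ (α - 4) * u x ^ 2) fun x hx => by simp [hu0 x hx],
    ← setIntegral_eq_integral_of_forall_compl_eq_zero (s := annulus n ρ R)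
      (f := fun x => ‖x‖ ^ α * lap u x ^ 2) fun x hx => by simp [hl0 x hx]]
  set I := ∫ x in annulus n ρ R, ‖x‖ ^ (α - 4) * u x ^ 2
  set J := ∫ x in annulus n ρ R, ‖x‖ ^ α * lap u x ^ 2
  set W := ∫ x in annulus n ρ R, ‖x‖ ^ (4 - α)
  have iI : IntegrableOn (fun x => ‖x‖ ^ (α - 4) * u x ^ 2) (annulus n ρ R) :=
    integrableOn_annulus_rpow_mul (f := fun x => u x ^ 2) hρ _ (huc.pow 2)
  have iJ : IntegrableOn (fun x => ‖x‖ ^ α * lap u x ^ 2) (annulus n ρ R) :=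
    integrableOn_annulus_rpow_mul (f := fun x => lap u x ^ 2) hρ _ (hlc.pow 2)
  have iW : IntegrableOn (fun x => ‖x‖ ^ (4 - α)) (annulus n ρ R) :=
    integrableOn_annulus hρ (continuousOn_norm_rpow _)
  have key : ∀ ε : ℝ, 0 < ε → δ * I ≤ J + δ * (ε ^ 2 * W) := by
    intro ε hε
    obtain ⟨p, hp⟩ := exists_polyFun_near (isCompact_annulus n ρ R)
      (h := fun x => ‖x‖ ^ (α - 4) * u x)
      (((continuousOn_norm_rpow _).mul huc).mono fun x hx => hne x hx) hε
    obtain ⟨v, hv, hΔ, hest⟩ := exists_solution_polyFun hγ hδ hρ hR p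
    have hvc : ContinuousOn v {0}ᶜ := fun x hx => (hv x hx).continuousAt.continuousWithinAt
    have hgc : ContinuousOn (polyFun p) {0}ᶜ :=
      (contDiff_polyFun p (k := 0)).continuous.continuousOn
    have hparts := integral_mul_lap_eq hu hc fun x hx => hv x (hne x (hA hx))
    have hparts : ∫ x in annulus n ρ R, v x * lap u x =
        ∫ x in annulus n ρ R, u x * polyFun p x := by
      rw [← setIntegral_eq_integral_of_forall_compl_eq_zero (s := annulus n ρ R)
          (f := fun x => v x * lap u x) fun x hx => by simp [hl0 x hx],
        ← setIntegral_eq_integral_of_forall_compl_eq_zero (s := annulus n ρ R)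
          (f := fun x => u x * _) fun x hx => by simp [hu0 x hx]] at hparts
      rw [hparts]
      exact setIntegral_congr_fun measurableSet_annulus fun x hx => by simp only [hΔ x (hne x hx)]
    have ivl : IntegrableOn (fun x => v x * lap u x) (annulus n ρ R) :=
      integrableOn_annulus hρ (hvc.mul hlc)
    have iug : IntegrableOn (fun x => u x * polyFun p x) (annulus n ρ R) :=
      integrableOn_annulus hρ (huc.mul hgc)
    have iv : IntegrableOn (fun x => ‖x‖ ^ (-α) * v x ^ 2) (annulus n ρ R) :=
      integrableOn_annulus_rpow_mul (f := fun x => v x ^ 2) hρ _ (hvc.pow 2)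
    have ig : IntegrableOn (fun x => ‖x‖ ^ (4 - α) * polyFun p x ^ 2) (annulus n ρ R) :=
      integrableOn_annulus_rpow_mul (f := fun x => polyFun p x ^ 2) hρ _ (hgc.pow 2)
    have h1 : ∫ x in annulus n ρ R, 2 * δ * (v x * lap u x) ≤
        ∫ x in annulus n ρ R, (‖x‖ ^ α * lap u x ^ 2 + δ ^ 2 * (‖x‖ ^ (-α) * v x ^ 2)) := by
      refine setIntegral_mono_on (ivl.const_mul _) (iJ.add (iv.const_mul _))
        measurableSet_annulus fun x hx => ?_
      have hr : 0 < ‖x‖ := norm_pos_iff.2 (hne x hx)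
      rw [Real.rpow_neg hr.le]
      have ht : 0 < ‖x‖ ^ α := Real.rpow_pos_of_pos hr α
      have : 0 ≤ (‖x‖ ^ α)⁻¹ * (‖x‖ ^ α * lap u x - δ * v x) ^ 2 := by positivity
      have e : (‖x‖ ^ α)⁻¹ * (‖x‖ ^ α * lap u x - δ * v x) ^ 2 = ‖x‖ ^ α * lap u x ^ 2 +
          δ ^ 2 * ((‖x‖ ^ α)⁻¹ * v x ^ 2) - 2 * δ * (v x * lap u x) := by
        field_simp
        ring
      linarith
    have h2 : ∫ x in annulus n ρ R, (‖x‖ ^ (α - 4) * u x ^ 2 +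
        ‖x‖ ^ (4 - α) * polyFun p x ^ 2) ≤
        ∫ x in annulus n ρ R, (2 * (u x * polyFun p x) + ε ^ 2 * ‖x‖ ^ (4 - α)) := by
      refine setIntegral_mono_on (iI.add ig) ((iug.const_mul _).add (iW.const_mul _))
        measurableSet_annulus fun x hx => ?_
      have hr : 0 < ‖x‖ := norm_pos_iff.2 (hne x hx)
      have hpx := hp x hx
      rw [show α - 4 = -(4 - α) by ring, Real.rpow_neg hr.le] at hpx ⊢
      have ht : 0 < ‖x‖ ^ (4 - α) := Real.rpow_pos_of_pos hr _
      have h3 := mul_le_mul_of_nonneg_left (sq_le_sq' (abs_lt.1 hpx).1.le (abs_lt.1 hpx).2.le) ht.le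
      have e : ‖x‖ ^ (4 - α) * (polyFun p x - (‖x‖ ^ (4 - α))⁻¹ * u x) ^ 2 =
          (‖x‖ ^ (4 - α))⁻¹ * u x ^ 2 + ‖x‖ ^ (4 - α) * polyFun p x ^ 2 -
            2 * (u x * polyFun p x) := by
        field_simp
        ring
      linarith
    rw [integral_add iJ (iv.const_mul _), integral_const_mul, integral_const_mul] at h1
    rw [integral_add iI ig, integral_add (iug.const_mul _) (iW.const_mul _), integral_const_mul,
      integral_const_mul] at h2
    rw [hparts] at h1
    have h3 := mul_le_mul_of_nonneg_left hest hδ0.le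
    have h4 := mul_le_mul_of_nonneg_left h2 hδ0.le
    linarith
  have hlim : Filter.Tendsto (fun ε : ℝ => J + δ * (ε ^ 2 * W)) (nhdsWithin 0 (Set.Ioi 0))
      (nhds J) := by
    have : Continuous fun ε : ℝ => J + δ * (ε ^ 2 * W) := by fun_prop
    simpa using (this.tendsto 0).mono_left nhdsWithin_le_nhds
  exact ge_of_tendsto hlim (eventually_mem_nhdsWithin.mono fun ε hε => key ε hε)

end Duality

section Gradient

variable {n : ℕ}

lemma integrable_norm_rpow_mul {s : ℝ} {f u : EuclideanSpace ℝ (Fin n) → ℝ}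
    (hc : HasCompactSupport u) (h0 : (0 : EuclideanSpace ℝ (Fin n)) ∉ tsupport u)
    (hf : Continuous f) (hfu : ∀ x, x ∉ tsupport u → f x = 0) :
    Integrable fun x => ‖x‖ ^ s * f x := by
  refine integrable_of_continuousAt_tsupport hc.isCompact
    (closure_minimal (fun x hx => ?_) (isClosed_tsupport u)) fun x hx => ?_
  · by_contra hxu
    exact hx (by simp [hfu x hxu])
  · have hx0 : x ≠ 0 := fun h => h0 (h ▸ hx)
    exact ((continuousOn_norm_rpow s).continuousAt (isOpen_compl_singleton.mem_nhds hx0)).mul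
      hf.continuousAt

lemma integral_norm_rpow_mul_gradient_sq_le {α : ℝ} {u : EuclideanSpace ℝ (Fin n) → ℝ}
    (hu : ContDiff ℝ 2 u) (hc : HasCompactSupport u)
    (h0 : (0 : EuclideanSpace ℝ (Fin n)) ∉ tsupport u) :
    ∫ x, ‖x‖ ^ (α - 2) * ‖gradient u x‖ ^ 2 ≤
      (∫ x, ‖x‖ ^ α * lap u x ^ 2) + (1 + (α - 2) ^ 2) * ∫ x, ‖x‖ ^ (α - 4) * u x ^ 2 := by
  have hpu : ∀ i, ContDiff ℝ 1 (partialD i u) := fun i =>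
    contDiff_iff_contDiffAt.2 fun x => contDiffAt_partialD hu.contDiffAt (by norm_num)
  have hu1 : ContDiff ℝ 1 u := hu.of_le (by norm_num)
  have hp0 : ∀ i, ∀ x, x ∉ tsupport u → partialD i u x = 0 := fun i x hx =>
    image_eq_zero_of_notMem_tsupport fun h => hx (tsupport_partialD_subset h)
  have hω : ∀ x : EuclideanSpace ℝ (Fin n), x ≠ 0 → ContDiffAt ℝ 1 (fun y => ‖y‖ ^ (α - 2)) x :=
    fun x hx => (contDiffAt_norm ℝ hx).rpow_const_of_ne (norm_ne_zero_iff.2 hx)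
  set F : Fin n → EuclideanSpace ℝ (Fin n) → ℝ := fun i y =>
    ‖y‖ ^ (α - 2) * (u y * partialD i u y) with hFdef
  have hFt : ∀ i, tsupport (F i) ⊆ tsupport u := fun i =>
    closure_mono fun x hx hux => hx (by simp [hFdef, hux])
  have hF : ∀ i, ContDiff ℝ 1 (F i) := fun i => contDiff_of_contDiffAt_tsupport fun x hx =>
    (hω x fun h => h0 (h ▸ hFt i hx)).mul (hu1.contDiffAt.mul (hpu i).contDiffAt)
  have hFc : ∀ i, HasCompactSupport (F i) := fun i =>
    HasCompactSupport.of_support_subset_isCompact hc.isCompact (subset_closure.trans (hFt i))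
  have hdiv := integral_sum_partialD_eq_zero hF hFc
  have iG : Integrable fun x => ‖x‖ ^ (α - 2) * ‖gradient u x‖ ^ 2 := by
    simp only [← sum_partialD_sq]
    exact integrable_norm_rpow_mul hc h0
      (continuous_finsetSum _ fun i _ => (hpu i).continuous.pow 2)
      fun x hx => Finset.sum_eq_zero fun i _ => by simp [hp0 i x hx]
  have iJ : Integrable fun x => ‖x‖ ^ α * lap u x ^ 2 :=
    integrable_norm_rpow_mul hc h0 ((continuous_lap hu).pow 2)
      fun x hx => by simp [lap_eq_zero_of_notMem hu hx]
  have iI : Integrable fun x => ‖x‖ ^ (α - 4) * u x ^ 2 :=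
    integrable_norm_rpow_mul hc h0 (hu.continuous.pow 2)
      fun x hx => by simp [image_eq_zero_of_notMem_tsupport hx]
  have iD : Integrable fun x => ∑ i, partialD i (F i) x := by
    refine integrable_finsetSum _ fun i _ => Continuous.integrable_of_hasCompactSupport ?_
      ((hFc i).mono' (subset_closure.trans tsupport_partialD_subset))
    exact ((hF i).continuous_fderiv one_ne_zero).clm_apply continuous_const
  have iJI : Integrable fun x => ‖x‖ ^ α * lap u x ^ 2 +
      (1 + (α - 2) ^ 2) * (‖x‖ ^ (α - 4) * u x ^ 2) := iJ.add (iI.const_mul _)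
  have hle : ∫ x, ‖x‖ ^ (α - 2) * ‖gradient u x‖ ^ 2 ≤ ∫ x, ((‖x‖ ^ α * lap u x ^ 2 +
      (1 + (α - 2) ^ 2) * (‖x‖ ^ (α - 4) * u x ^ 2)) + 2 * ∑ i, partialD i (F i) x) := by
    refine integral_mono iG (iJI.add (iD.const_mul _)) fun x => ?_
    by_cases hx : x ∈ tsupport u
    · have hx0 : x ≠ 0 := fun h => h0 (h ▸ hx)
      have hr : 0 < ‖x‖ := norm_pos_iff.2 hx0
      have hd : ∀ i, partialD i (F i) x = ‖x‖ ^ (α - 4) * ((α - 2) * u x * (x i * partialD i u x)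
          + ‖x‖ ^ 2 * partialD i u x ^ 2 + ‖x‖ ^ 2 * u x * partialD i (partialD i u) x) := by
        intro i
        have h1 := Real.hasDerivAt_rpow_const (p := α - 2) (Or.inl hr.ne')
        have e1 : ‖x‖ ^ (α - 2) = ‖x‖ ^ (α - 4) * ‖x‖ ^ 2 := by
          rw [← Real.rpow_natCast ‖x‖ 2, ← Real.rpow_add hr]
          congr 1; push_cast; ring
        have e2 : ‖x‖ ^ (α - 2 - 1) = ‖x‖ ^ (α - 4) * ‖x‖ := by
          rw [← Real.rpow_add_one hr.ne']
          congr 1; ring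
        have hud := hu1.differentiable one_ne_zero x
        have hpd := (hpu i).differentiable one_ne_zero x
        simp only [hFdef]
        rw [partialD_mul ((hω x hx0).differentiableAt one_ne_zero) (hud.fun_mul hpd),
          partialD_mul hud hpd, partialD_radial hx0 h1, e1, e2]
        field_simp
        ring
      have e1 : ‖x‖ ^ (α - 2) = ‖x‖ ^ (α - 4) * ‖x‖ ^ 2 := by
        rw [← Real.rpow_natCast ‖x‖ 2, ← Real.rpow_add hr]
        congr 1; push_cast; ring
      have e2 : ‖x‖ ^ α = ‖x‖ ^ (α - 4) * (‖x‖ ^ 2) ^ 2 := by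
        rw [← pow_mul, ← Real.rpow_natCast ‖x‖ (2 * 2), ← Real.rpow_add hr]
        congr 1; push_cast; ring
      have hcs := Finset.sum_mul_sq_le_sq_mul_sq Finset.univ (fun i => x i) fun i => partialD i u x
      simp only [hd, ← Finset.mul_sum, Finset.sum_add_distrib, ← lap_eq_sum_partialD hu, e1, e2,
        sum_partialD_sq]
      simp only [sum_partialD_sq, sq (x _), sum_sq_eq_norm_sq] at hcs
      have hw : 0 ≤ ‖x‖ ^ (α - 4) := Real.rpow_nonneg hr.le _
      have h1 := mul_nonneg hw (sq_nonneg ((α - 2) * u x + ∑ i, x i * partialD i u x))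
      have h2 := mul_nonneg hw (sq_nonneg (‖x‖ ^ 2 * lap u x + u x))
      have h3 := mul_le_mul_of_nonneg_left hcs hw
      linarith
    · have hz : ∀ i, partialD i (F i) x = 0 := fun i =>
        image_eq_zero_of_notMem_tsupport fun h => hx (hFt i (tsupport_partialD_subset h))
      simp [← sum_partialD_sq, hp0 _ x hx, hz, image_eq_zero_of_notMem_tsupport hx,
        lap_eq_zero_of_notMem hu hx]
  rw [integral_add iJI (iD.const_mul _), integral_add iJ (iI.const_mul _),
    integral_const_mul, integral_const_mul, hdiv] at hle
  linarith

end Gradient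

theorem statement13 (n : ℕ) (hn : 2 ≤ n) (α : ℝ) (hα : α ≠ 4 - (n : ℝ))
    (γ : ℝ) (hγ : γ = ((n : ℝ) - 4 + α) * ((n : ℝ) - α) / 4)
    (hspec : ∀ k : ℕ, γ + (k : ℝ) * ((n : ℝ) - 2 + (k : ℝ)) ≠ 0) :
    ∃ c : ℝ, 0 < c ∧ ∀ u : EuclideanSpace ℝ (Fin n) → ℝ,
      ContDiff ℝ 2 u → HasCompactSupport u →
      (0 : EuclideanSpace ℝ (Fin n)) ∉ tsupport u →
      (∫ x : EuclideanSpace ℝ (Fin n), ‖x‖ ^ α * (lap u x) ^ 2) ≥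
        c * (∫ x : EuclideanSpace ℝ (Fin n), ‖x‖ ^ (α - 2) * ‖gradient u x‖ ^ 2) := by
  have : NeZero n := ⟨by omega⟩
  obtain ⟨δ, hδ0, hδ⟩ := exists_pos_forall_le_sq hn hspec
  refine ⟨(1 + (1 + (α - 2) ^ 2) / δ)⁻¹, by positivity, fun u hu hc h0 => ?_⟩
  have h1 := rellich hγ hδ0 hδ hu hc h0
  have h2 := integral_norm_rpow_mul_gradient_sq_le (α := α) hu hc h0
  rw [ge_iff_le, inv_mul_le_iff₀ (by positivity)]
  refine h2.trans ?_
  rw [mul_comm δ, ← le_div_iff₀ hδ0] at h1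
  have h3 := mul_le_mul_of_nonneg_left h1 (show 0 ≤ 1 + (α - 2) ^ 2 by positivity)
  calc _ ≤ _ := add_le_add le_rfl h3
    _ = _ := by ring
end

section
/- Let n ≥ 2 be an integer and α ∈ ℝ with α ≠ 4-n, and set γ = (n-4+α)(n-α)/4. Assume that γ + k(n-2+k) = 0 for some integer k ≥ 0. Then for every ε > 0 there exists a function u : ℝⁿ → ℝ of class C² with compact support contained in ℝⁿ \ {0} such that ∫_{ℝⁿ} |x|^{α-2} |∇u(x)|² dx ≠ 0 and ∫_{ℝⁿ} |x|^α |Δu(x)|² dx < ε ∫_{ℝⁿ} |x|^{α-2} |∇u(x)|² dx. (That is, the best constant δ_{n,α} equals 0.) -/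
open MeasureTheory

open Set Filter Topology

theorem integral_eq_of_polar {E : Type*} [NormedAddCommGroup E] [NormedSpace ℝ E]
    [MeasurableSpace E] [BorelSpace E] [FiniteDimensional ℝ E] [Nontrivial E]
    (μ : Measure E) [μ.IsAddHaarMeasure] {f : E → ℝ} {F : ℝ → ℝ} {Y : E → ℝ} {c : ℝ}
    (hc : 0 < c)
    (hf : ∀ ω : E, ‖ω‖ = 1 → ∀ r : ℝ, 0 < r →
      f (r • ω) = r ^ (-(Module.finrank ℝ E : ℝ)) * F (c * Real.log r) * Y ω) :
    ∫ x, f x ∂μ = (∫ ω : Metric.sphere (0 : E) 1, Y ω ∂μ.toSphere) * (c⁻¹ * ∫ t, F t) := by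
  set d := Module.finrank ℝ E with hd
  have hd0 : 0 < d := Module.finrank_pos
  calc
    ∫ x, f x ∂μ = ∫ x : ({(0)}ᶜ : Set E), f x.1 ∂(μ.comap (↑)) := by
      rw [integral_subtype_comap (measurableSet_singleton _).compl f,
        restrict_compl_singleton]
    _ = ∫ p : Metric.sphere (0 : E) 1 × Ioi (0 : ℝ),
          Y p.1 * (p.2.1 ^ (-(d : ℝ)) * F (c * Real.log p.2.1))
          ∂μ.toSphere.prod (.volumeIoiPow (d - 1)) := by
      rw [← μ.measurePreserving_homeomorphUnitSphereProd.integral_comp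
        (Homeomorph.measurableEmbedding _)]
      refine integral_congr_ae (.of_forall fun x => ?_)
      have hx : (x : E) ≠ 0 := x.2
      have hx' : 0 < ‖(x : E)‖ := norm_pos_iff.2 hx
      have h := hf (‖(x : E)‖⁻¹ • (x : E)) (by rw [norm_smul, norm_inv, norm_norm,
        inv_mul_cancel₀ hx'.ne']) _ hx'
      rw [smul_smul, mul_inv_cancel₀ hx'.ne', one_smul] at h
      simp only [homeomorphUnitSphereProd_apply_snd_coe, homeomorphUnitSphereProd_apply_fst_coe]
      rw [h]; ring
    _ = (∫ ω : Metric.sphere (0 : E) 1, Y ω ∂μ.toSphere) *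
        ∫ r : Ioi (0 : ℝ), r.1 ^ (-(d : ℝ)) * F (c * Real.log r.1) ∂.volumeIoiPow (d - 1) :=
      integral_prod_mul (fun ω : Metric.sphere (0 : E) 1 => Y ω)
        (fun r : Ioi (0 : ℝ) => r.1 ^ (-(d : ℝ)) * F (c * Real.log r.1))
    _ = (∫ ω : Metric.sphere (0 : E) 1, Y ω ∂μ.toSphere) *
        ∫ r in Ioi (0 : ℝ), r⁻¹ * F (c * Real.log r) := by
      congr 1
      simp only [Measure.volumeIoiPow, ENNReal.ofReal]
      rw [integral_withDensity_eq_integral_smul,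
        integral_subtype_comap measurableSet_Ioi fun a ↦ Real.toNNReal (a ^ (d - 1)) •
          (a ^ (-(d : ℝ)) * F (c * Real.log a)),
        setIntegral_congr_fun measurableSet_Ioi fun x hx ↦ ?_]
      · rw [NNReal.smul_def, Real.coe_toNNReal _ (pow_nonneg hx.out.le _), smul_eq_mul,
          ← mul_assoc, ← Real.rpow_natCast, ← Real.rpow_add hx, ← Real.rpow_neg_one,
          Nat.cast_pred hd0]
        congr 2; ring
      · exact (measurable_subtype_coe.pow_const _).real_toNNReal
    _ = (∫ ω : Metric.sphere (0 : E) 1, Y ω ∂μ.toSphere) * ∫ t, F (c * t) := by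
      congr 1
      rw [← Real.range_exp, ← image_univ, integral_image_eq_integral_abs_deriv_smul (f' := Real.exp)
        MeasurableSet.univ (fun x _ => (Real.hasDerivAt_exp x).hasDerivWithinAt)
        Real.exp_injective.injOn, setIntegral_univ]
      refine integral_congr_ae (.of_forall fun x => ?_)
      simp only [Real.log_exp, abs_of_pos (Real.exp_pos x), smul_eq_mul]
      rw [mul_inv_cancel_left₀ (Real.exp_pos x).ne']
    _ = _ := by
      rw [Measure.integral_comp_mul_left, abs_of_pos (inv_pos.2 hc), smul_eq_mul]

theorem hasDerivAt_rpow_mul_comp_log {G : ℝ → ℝ} {G' a δ q : ℝ} (hq : 0 < q)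
    (hG : HasDerivAt G G' (δ * Real.log q)) :
    HasDerivAt (fun q => q ^ a * G (δ * Real.log q))
      (q ^ (a - 1) * (a * G (δ * Real.log q) + δ * G')) q := by
  have h1 := Real.hasDerivAt_rpow_const (p := a) (Or.inl hq.ne')
  have h2 := HasDerivAt.comp q hG ((Real.hasDerivAt_log hq.ne').const_mul δ)
  refine (h1.mul h2).congr_deriv ?_
  have : q ^ a = q ^ (a - 1) * q := by
    rw [Real.rpow_sub_one hq.ne', div_mul_cancel₀ _ hq.ne']
  simp only [Function.comp, this]
  field_simp

section line

variable {E : Type*} [NormedAddCommGroup E] [InnerProductSpace ℝ E]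

theorem hasDerivAt_norm_sq_line (x v : E) (t : ℝ) :
    HasDerivAt (fun t : ℝ => ‖x + t • v‖ ^ 2) (2 * inner ℝ (x + t • v) v) t := by
  have h : HasDerivAt (fun t : ℝ => x + t • v) v t := by
    simpa using ((hasDerivAt_id t).smul_const v).const_add x
  exact h.norm_sq

theorem hasDerivAt_re_pow_line (z : E →L[ℝ] ℂ) (k : ℕ) (c : ℂ) (x v : E) (t : ℝ) :
    HasDerivAt (fun t : ℝ => (c * z (x + t • v) ^ k).re)
      ((c * (k * z (x + t • v) ^ (k - 1) * z v)).re) t := by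
  have h : HasDerivAt (fun t : ℝ => x + t • v) v t := by
    simpa using ((hasDerivAt_id t).smul_const v).const_add x
  have h1 : HasDerivAt (fun t : ℝ => z (x + t • v)) (z v) t :=
    z.hasFDerivAt.comp_hasDerivAt t h
  exact Complex.reCLM.hasFDerivAt.comp_hasDerivAt t ((h1.pow k).const_mul c)

theorem fderiv_radial_mul_re_pow {ψ ψ₁ : ℝ → ℝ} (hψ : ∀ q, 0 < q → HasDerivAt ψ (ψ₁ q) q)
    (z : E →L[ℝ] ℂ) (k : ℕ) {u : E → ℝ} (hu : ∀ x, u x = ψ (‖x‖ ^ 2) * (z x ^ k).re)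
    {x : E} (hx : x ≠ 0) (hd : DifferentiableAt ℝ u x) (v : E) :
    fderiv ℝ u x v = 2 * inner ℝ x v * ψ₁ (‖x‖ ^ 2) * (z x ^ k).re +
      ψ (‖x‖ ^ 2) * (z v * (k * z x ^ (k - 1))).re := by
  have h1 := hasDerivAt_norm_sq_line x v 0
  have h2 := hasDerivAt_re_pow_line z k 1 x v 0
  have h3 : HasDerivAt ψ (ψ₁ (‖x + (0 : ℝ) • v‖ ^ 2)) (‖x + (0 : ℝ) • v‖ ^ 2) :=
    hψ _ (pow_pos (norm_pos_iff.2 (by simpa using hx)) 2)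
  have h4 := (h3.comp (0 : ℝ) h1).mul h2
  have h5 : HasDerivAt (fun t : ℝ => x + t • v) v 0 := by
    simpa using ((hasDerivAt_id (0 : ℝ)).smul_const v).const_add x
  have h6 : HasDerivAt (fun t : ℝ => u (x + t • v)) (fderiv ℝ u x v) 0 :=
    HasFDerivAt.comp_hasDerivAt (0 : ℝ) (by simpa using hd.hasFDerivAt) h5
  have h7 : (fun t : ℝ => u (x + t • v)) =
      (ψ ∘ fun t : ℝ => ‖x + t • v‖ ^ 2) * fun t : ℝ => (1 * z (x + t • v) ^ k).re := by
    ext t; simp [hu]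
  rw [h7] at h6
  rw [h6.unique h4]
  simp only [zero_smul, add_zero, Function.comp, one_mul]
  rw [mul_comm (z v)]
  ring

theorem fderiv_fderiv_radial_mul_re_pow {ψ ψ₁ ψ₂ : ℝ → ℝ}
    (hψ : ∀ q, 0 < q → HasDerivAt ψ (ψ₁ q) q) (hψ₁ : ∀ q, 0 < q → HasDerivAt ψ₁ (ψ₂ q) q)
    (z : E →L[ℝ] ℂ) (k : ℕ) {u : E → ℝ} (hu : ∀ x, u x = ψ (‖x‖ ^ 2) * (z x ^ k).re)
    (hd : ContDiff ℝ 2 u) {x : E} (hx : x ≠ 0) (v : E) :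
    fderiv ℝ (fderiv ℝ u) x v v =
      2 * ‖v‖ ^ 2 * ψ₁ (‖x‖ ^ 2) * (z x ^ k).re +
      4 * inner ℝ x v ^ 2 * ψ₂ (‖x‖ ^ 2) * (z x ^ k).re +
      4 * ψ₁ (‖x‖ ^ 2) * (inner ℝ x v * (z v * (k * z x ^ (k - 1))).re) +
      ψ (‖x‖ ^ 2) * (z v ^ 2 * (k * ((k - 1 : ℕ) * z x ^ (k - 1 - 1)))).re := by
  have h5 : HasDerivAt (fun t : ℝ => x + t • v) v 0 := by
    simpa using ((hasDerivAt_id (0 : ℝ)).smul_const v).const_add x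
  have h1 := hasDerivAt_norm_sq_line x v 0
  have h2 := hasDerivAt_re_pow_line z k 1 x v 0
  have h2' := hasDerivAt_re_pow_line z (k - 1) (z v * k) x v 0
  have hq : 0 < ‖x + (0 : ℝ) • v‖ ^ 2 :=
    pow_pos (norm_pos_iff.2 (by simpa using hx)) 2
  have h3 := (hψ _ hq).comp (0 : ℝ) h1
  have h3' := (hψ₁ _ hq).comp (0 : ℝ) h1
  have hi : HasDerivAt (fun t : ℝ => inner ℝ (x + t • v) v) (inner ℝ v v) 0 := by
    simpa using h5.inner ℝ (hasDerivAt_const (0 : ℝ) v)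
  have h4 := (((hi.const_mul 2).mul h3').mul h2).add (h3.mul h2')
  have hdd : DifferentiableAt ℝ (fderiv ℝ u) x :=
    (hd.fderiv_right (m := 1) le_rfl).differentiable one_ne_zero x
  have h6 : HasDerivAt (fun t : ℝ => fderiv ℝ u (x + t • v) v)
      (fderiv ℝ (fderiv ℝ u) x v v) 0 := by
    have := HasFDerivAt.comp_hasDerivAt (l := fderiv ℝ u) (0 : ℝ)
      (by simpa using hdd.hasFDerivAt) h5
    simpa using this.clm_apply (hasDerivAt_const (0 : ℝ) v)
  have h8 : ∀ᶠ t : ℝ in 𝓝 0, x + t • v ≠ 0 :=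
    h5.continuousAt.eventually_ne (by simpa using hx)
  refine ((h4.congr_of_eventuallyEq ?_).unique h6).symm.trans ?_
  · filter_upwards [h8] with t ht
    rw [fderiv_radial_mul_re_pow hψ z k hu ht (hd.differentiable two_ne_zero _)]
    simp [mul_assoc]
  · simp only [zero_smul, add_zero, Function.comp, one_mul, real_inner_self_eq_norm_sq,
      Pi.mul_apply]
    have e1 : z v * k * (((k - 1 : ℕ) : ℂ) * z x ^ (k - 1 - 1) * z v) =
      z v ^ 2 * (k * ((k - 1 : ℕ) * z x ^ (k - 1 - 1))) := by ring
    have e2 : (k : ℂ) * z x ^ (k - 1) * z v = z v * (k * z x ^ (k - 1)) := by ring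
    rw [e1, e2, mul_assoc (z v)]
    ring

end line

theorem natCast_mul_pow_pred_mul_self {R : Type*} [CommSemiring R] (w : R) (k : ℕ) :
    w * (k * w ^ (k - 1)) = k * w ^ k := by
  rcases k with _ | k
  · simp
  · simp only [Nat.add_sub_cancel]; ring

theorem lap_radial_mul_re_pow {n : ℕ} {ψ ψ₁ ψ₂ : ℝ → ℝ}
    (hψ : ∀ q, 0 < q → HasDerivAt ψ (ψ₁ q) q) (hψ₁ : ∀ q, 0 < q → HasDerivAt ψ₁ (ψ₂ q) q)
    (z : EuclideanSpace ℝ (Fin n) →L[ℝ] ℂ)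
    (hz : ∑ i, z (EuclideanSpace.single i 1) ^ 2 = 0) (k : ℕ)
    {u : EuclideanSpace ℝ (Fin n) → ℝ} (hu : ∀ x, u x = ψ (‖x‖ ^ 2) * (z x ^ k).re)
    (hd : ContDiff ℝ 2 u) {x : EuclideanSpace ℝ (Fin n)} (hx : x ≠ 0) :
    lap u x = (4 * ‖x‖ ^ 2 * ψ₂ (‖x‖ ^ 2) + (2 * n + 4 * k) * ψ₁ (‖x‖ ^ 2)) * (z x ^ k).re := by
  have hsum : ∑ i, (x i : ℂ) * z (EuclideanSpace.single i 1) = z x := by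
    conv_rhs => rw [← (EuclideanSpace.basisFun (Fin n) ℝ).sum_repr x, map_sum]
    simp
  have hsum1 : ∑ i, x i * (z (EuclideanSpace.single i 1) * (k * z x ^ (k - 1))).re =
      k * (z x ^ k).re := by
    have : ((∑ i, (x i : ℂ) * z (EuclideanSpace.single i 1)) * (k * z x ^ (k - 1))).re =
        k * (z x ^ k).re := by
      rw [hsum, natCast_mul_pow_pred_mul_self]
      simp [Complex.mul_re]
    rw [← this, Finset.sum_mul, Complex.re_sum]
    refine Finset.sum_congr rfl fun i _ => ?_
    rw [mul_assoc, Complex.re_ofReal_mul]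
  have hsum2 : ∑ i, (z (EuclideanSpace.single i 1) ^ 2 *
      (k * ((k - 1 : ℕ) * z x ^ (k - 1 - 1)))).re = 0 := by
    rw [← Complex.re_sum, ← Finset.sum_mul, hz, zero_mul, Complex.zero_re]
  have hsum3 : ∑ i, x i ^ 2 = ‖x‖ ^ 2 := by
    rw [EuclideanSpace.norm_sq_eq]; simp
  unfold lap
  simp only [iteratedFDeriv_two_apply, Matrix.cons_val_zero, Matrix.cons_val_one,
    fderiv_fderiv_radial_mul_re_pow hψ hψ₁ z k hu hd hx]
  simp only [Finset.sum_add_distrib, ← Finset.mul_sum, ← Finset.sum_mul, hsum2]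
  simp only [EuclideanSpace.inner_single_right, PiLp.norm_single]
  simp only [conj_trivial, one_mul, hsum1, hsum3, norm_one, Finset.sum_const,
    Finset.card_univ, Fintype.card_fin, nsmul_eq_mul]
  ring

theorem abs_fderiv_self_le_norm_gradient_mul {E : Type*} [NormedAddCommGroup E]
    [InnerProductSpace ℝ E] [CompleteSpace E] (u : E → ℝ) (x : E) :
    |fderiv ℝ u x x| ≤ ‖gradient u x‖ * ‖x‖ := by
  rw [← inner_gradient_left]
  exact abs_real_inner_le_norm _ _

theorem integral_smul_add_sq {p q : ℝ → ℝ} (hp : Continuous p) (hq : Continuous q)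
    (hps : HasCompactSupport p) (hqs : HasCompactSupport q) (δ : ℝ) :
    ∫ t, (δ * p t + q t) ^ 2 =
      δ ^ 2 * (∫ t, p t * p t) + 2 * δ * (∫ t, p t * q t) + ∫ t, q t * q t := by
  have h1 : Integrable (fun t => p t * p t) :=
    (hp.mul hp).integrable_of_hasCompactSupport hps.mul_left
  have h2 : Integrable (fun t => p t * q t) :=
    (hp.mul hq).integrable_of_hasCompactSupport hqs.mul_left
  have h3 : Integrable (fun t => q t * q t) :=
    (hq.mul hq).integrable_of_hasCompactSupport hqs.mul_left
  rw [← integral_const_mul, ← integral_const_mul, ← integral_add, ← integral_add]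
  · congr 1; ext t; ring
  · exact (h1.const_mul _).add (h2.const_mul _)
  · exact h3
  · exact h1.const_mul _
  · exact h2.const_mul _

theorem tendsto_integral_smul_add_sq {p q : ℝ → ℝ} (hp : Continuous p) (hq : Continuous q)
    (hps : HasCompactSupport p) (hqs : HasCompactSupport q) :
    Tendsto (fun δ : ℝ => ∫ t, (δ * p t + q t) ^ 2) (𝓝 0) (𝓝 (∫ t, q t * q t)) := by
  simp only [integral_smul_add_sq hp hq hps hqs]
  have h : Continuous fun δ : ℝ =>
    δ ^ 2 * (∫ t, p t * p t) + 2 * δ * (∫ t, p t * q t) + ∫ t, q t * q t := by fun_prop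
  simpa using h.tendsto 0

theorem integrable_norm_rpow_mul_norm_gradient_sq {E : Type*} [NormedAddCommGroup E]
    [InnerProductSpace ℝ E] [FiniteDimensional ℝ E] [MeasurableSpace E] [BorelSpace E]
    (μ : Measure E) [IsFiniteMeasureOnCompacts μ] {u : E → ℝ} (hu : ContDiff ℝ 2 u)
    (hc : HasCompactSupport u) (h0 : (0 : E) ∉ tsupport u) (β : ℝ) :
    Integrable (fun x => ‖x‖ ^ β * ‖gradient u x‖ ^ 2) μ := by
  have hg : Continuous (gradient u) :=
    (InnerProductSpace.toDual ℝ E).symm.continuous.comp (hu.continuous_fderiv two_ne_zero)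
  have hz : ∀ x ∉ tsupport u, gradient u x = 0 := fun x hx => by
    have := (notMem_tsupport_iff_eventuallyEq.1 hx).fderiv_eq (𝕜 := ℝ)
    rw [gradient, this]; simp
  refine Continuous.integrable_of_hasCompactSupport ?_ ?_
  · refine continuous_iff_continuousAt.2 fun x => ?_
    by_cases hx : x = 0
    · subst hx
      have : (fun _ => (0 : ℝ)) =ᶠ[𝓝 (0 : E)] fun x => ‖x‖ ^ β * ‖gradient u x‖ ^ 2 := by
        filter_upwards [(isClosed_tsupport u).isOpen_compl.mem_nhds h0] with y hy
        simp [hz y hy]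
      exact continuousAt_const.congr this
    · exact (continuous_norm.continuousAt.rpow_const (Or.inl (norm_ne_zero_iff.2 hx))).mul
        (hg.norm.pow 2).continuousAt
  · refine HasCompactSupport.intro hc fun x hx => ?_
    simp [hz x hx]

/-- The radially modulated harmonic polynomial `|x|^(2a) g(δ log |x|²) Re (z x)^k`. -/
noncomputable def modulated {E : Type*} [NormedAddCommGroup E] [NormedSpace ℝ E]
    (z : E →L[ℝ] ℂ) (k : ℕ) (g : ℝ → ℝ) (a δ : ℝ) (x : E) : ℝ :=
  (‖x‖ ^ 2) ^ a * g (δ * Real.log (‖x‖ ^ 2)) * (z x ^ k).re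

section modulated

variable {E : Type*} [NormedAddCommGroup E] [InnerProductSpace ℝ E]
  (z : E →L[ℝ] ℂ) (k : ℕ) {g : ℝ → ℝ} (a : ℝ) {δ : ℝ}

theorem modulated_eventuallyEq_zero (hg : ∀ t ≤ 0, g t = 0) (hδ : 0 < δ) :
    modulated z k g a δ =ᶠ[𝓝 0] 0 := by
  filter_upwards [Metric.ball_mem_nhds (0 : E) one_pos] with x hx
  have hx' : ‖x‖ ≤ 1 := (mem_ball_zero_iff.1 hx).le
  have : δ * Real.log (‖x‖ ^ 2) ≤ 0 :=
    mul_nonpos_of_nonneg_of_nonpos hδ.le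
      (Real.log_nonpos (by positivity) (pow_le_one₀ (norm_nonneg x) hx'))
  rw [modulated, hg _ this, mul_zero, zero_mul, Pi.zero_apply]

theorem contDiff_modulated (hgs : ContDiff ℝ 2 g) (hg : ∀ t ≤ 0, g t = 0) (hδ : 0 < δ) :
    ContDiff ℝ 2 (modulated z k g a δ) := by
  refine contDiff_iff_contDiffAt.2 fun x => ?_
  by_cases hx : x = 0
  · subst hx
    exact contDiffAt_const.congr_of_eventuallyEq (modulated_eventuallyEq_zero z k a hg hδ)
  · have hx' : ‖x‖ ^ 2 ≠ 0 := by simpa using hx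
    have hn : ContDiffAt ℝ 2 (fun x : E => ‖x‖ ^ 2) x := (contDiff_norm_sq ℝ).contDiffAt
    refine ((hn.rpow_const_of_ne hx').mul (hgs.contDiffAt.comp x
      (contDiffAt_const.mul (hn.log hx')))).mul ?_
    exact Complex.reCLM.contDiff.contDiffAt.comp x (z.contDiff.contDiffAt.pow k)

theorem hasCompactSupport_modulated [FiniteDimensional ℝ E] {R : ℝ} (hR : 0 ≤ R)
    (hg : ∀ t, R ≤ t → g t = 0) (hδ : 0 < δ) : HasCompactSupport (modulated z k g a δ) := by
  refine HasCompactSupport.intro (isCompact_closedBall (0 : E) (Real.exp (R / δ))) fun x hx => ?_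
  have hx' : Real.exp (R / δ) < ‖x‖ := by simpa using hx
  have h1 : R / δ ≤ Real.log ‖x‖ :=
    (Real.le_log_iff_exp_le ((Real.exp_pos _).trans hx')).2 hx'.le
  have h2 : R ≤ δ * Real.log (‖x‖ ^ 2) := by
    rw [Real.log_pow]
    rw [div_le_iff₀ hδ] at h1
    push_cast
    linarith
  rw [modulated, hg _ h2, mul_zero, zero_mul]

end modulated

theorem exists_isotropic {n : ℕ} (hn : 2 ≤ n) :
    ∃ z : EuclideanSpace ℝ (Fin n) →L[ℝ] ℂ, ∑ i, z (EuclideanSpace.single i 1) ^ 2 = 0 ∧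
      ∃ e, ‖e‖ = 1 ∧ z e = 1 := by
  let i₀ : Fin n := ⟨0, by omega⟩
  let i₁ : Fin n := ⟨1, by omega⟩
  have h01 : i₀ ≠ i₁ := by simp [i₀, i₁]
  let z : EuclideanSpace ℝ (Fin n) →L[ℝ] ℂ :=
    Complex.ofRealCLM.comp (EuclideanSpace.proj i₀) +
      Complex.I • Complex.ofRealCLM.comp (EuclideanSpace.proj i₁)
  have hz : ∀ x, z x = x i₀ + Complex.I * x i₁ := fun x => by simp [z]
  refine ⟨z, ?_, EuclideanSpace.single i₀ 1, by simp, by simp [hz, h01.symm]⟩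
  rw [← Finset.sum_subset (Finset.subset_univ {i₀, i₁}), Finset.sum_pair h01]
  · simp [hz, h01, h01.symm]
  · intro i _ hi
    simp only [Finset.mem_insert, Finset.mem_singleton, not_or] at hi
    simp [hz, Ne.symm hi.1, Ne.symm hi.2]

theorem re_pow_smul {E : Type*} [NormedAddCommGroup E] [NormedSpace ℝ E] (z : E →L[ℝ] ℂ)
    (k : ℕ) (r : ℝ) (x : E) : (z (r • x) ^ k).re = r ^ k * (z x ^ k).re := by
  rw [map_smul, Complex.real_smul, mul_pow, ← Complex.ofReal_pow, Complex.re_ofReal_mul]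

theorem sq_rpow_mul_pow_sq {r : ℝ} (hr : 0 < r) (a b : ℝ) (k : ℕ) :
    r ^ b * ((r ^ 2) ^ a * r ^ k) ^ 2 = r ^ (b + 4 * a + 2 * k) := by
  rw [← Real.rpow_natCast r 2, ← Real.rpow_natCast r k, ← Real.rpow_mul hr.le,
    ← Real.rpow_add hr, ← Real.rpow_natCast _ 2, ← Real.rpow_mul hr.le, ← Real.rpow_add hr]
  congr 1; push_cast; ring

theorem sphere_integral_re_pow_sq_pos {n : ℕ} (z : EuclideanSpace ℝ (Fin n) →L[ℝ] ℂ) (k : ℕ)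
    {e : EuclideanSpace ℝ (Fin n)} (he : ‖e‖ = 1) (hze : z e = 1) :
    0 < ∫ ω : Metric.sphere (0 : EuclideanSpace ℝ (Fin n)) 1, (z ω ^ k).re ^ 2
      ∂(volume : Measure (EuclideanSpace ℝ (Fin n))).toSphere := by
  have hcont : Continuous fun ω : Metric.sphere (0 : EuclideanSpace ℝ (Fin n)) 1 =>
      (z ω ^ k).re ^ 2 := by fun_prop
  refine hcont.integral_pos_of_hasCompactSupport_nonneg_nonzero
    (HasCompactSupport.of_compactSpace _) (fun ω => sq_nonneg _)
    (x := ⟨e, by simpa using he⟩) ?_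
  simp [hze]

theorem exists_bump : ∃ g : ℝ → ℝ, ContDiff ℝ 2 g ∧ HasCompactSupport g ∧
    (∀ t ≤ 0, g t = 0) ∧ (∀ t, 3 ≤ t → g t = 0) ∧ 0 < ∫ t, g t * g t := by
  let g : ContDiffBump (2 : ℝ) := ⟨1 / 2, 1, by norm_num, by norm_num⟩
  refine ⟨g, g.contDiff, g.hasCompactSupport, fun t ht => ?_, fun t ht => ?_, ?_⟩
  · exact g.zero_of_le_dist (by rw [Real.dist_eq, abs_of_neg] <;> simp [g] <;> linarith)
  · exact g.zero_of_le_dist (by rw [Real.dist_eq, abs_of_pos] <;> simp [g] <;> linarith)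
  · refine (g.continuous.mul g.continuous).integral_pos_of_hasCompactSupport_nonneg_nonzero
      g.hasCompactSupport.mul_left (fun t => mul_self_nonneg _) (x := 2) ?_
    have := g.pos_of_mem_ball (Metric.mem_ball_self g.rOut_pos)
    exact (mul_pos this this).ne'

section formulas

variable {n : ℕ} {z : EuclideanSpace ℝ (Fin n) →L[ℝ] ℂ} {k : ℕ} {g : ℝ → ℝ} {a δ : ℝ}

theorem norm_smul_of_norm_eq_one {E : Type*} [NormedAddCommGroup E] [NormedSpace ℝ E]
    {ω : E} (hω : ‖ω‖ = 1) {r : ℝ} (hr : 0 < r) : ‖r • ω‖ = r := by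
  rw [norm_smul, hω, mul_one, Real.norm_of_nonneg hr.le]

theorem lap_modulated (hz : ∑ i, z (EuclideanSpace.single i 1) ^ 2 = 0)
    (hgs : ContDiff ℝ 2 g) (hd : ContDiff ℝ 2 (modulated z k g a δ))
    (ha : a * (2 * a - 2 + n + 2 * k) = 0)
    {ω : EuclideanSpace ℝ (Fin n)} (hω : ‖ω‖ = 1) {r : ℝ} (hr : 0 < r) :
    lap (modulated z k g a δ) (r • ω) =
      ((r ^ 2) ^ (a - 1) * r ^ k) * (δ * (δ * (4 * deriv (deriv g) (2 * δ * Real.log r)) +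
        (8 * a - 4 + 2 * n + 4 * k) * deriv g (2 * δ * Real.log r))) * (z ω ^ k).re := by
  have hg1 : ∀ t, HasDerivAt g (deriv g t) t := fun t =>
    (hgs.differentiable two_ne_zero t).hasDerivAt
  have hg2 : ∀ t, HasDerivAt (deriv g) (deriv (deriv g) t) t := fun t =>
    ((contDiff_succ_iff_deriv (n := 1)).1 hgs).2.2.differentiable one_ne_zero t |>.hasDerivAt
  have hψ := fun q (hq : 0 < q) => hasDerivAt_rpow_mul_comp_log (a := a) (δ := δ) hq (hg1 _)
  have hψ₁ := fun q (hq : 0 < q) => hasDerivAt_rpow_mul_comp_log (a := a - 1) (δ := δ)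
    (G := fun t => a * g t + δ * deriv g t) hq (((hg1 _).const_mul a).add ((hg2 _).const_mul δ))
  have hrω : r • ω ≠ 0 := smul_ne_zero hr.ne' (norm_ne_zero_iff.1 (by rw [hω]; exact one_ne_zero))
  rw [lap_radial_mul_re_pow hψ hψ₁ z hz k (u := modulated z k g a δ) (fun x => rfl) hd hrω,
    re_pow_smul,
    norm_smul_of_norm_eq_one hω hr, Real.rpow_sub_one (by positivity) (a - 1), Real.log_pow]
  have e : δ * (((2 : ℕ) : ℝ) * Real.log r) = 2 * δ * Real.log r := by push_cast; ring
  simp only [e]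
  field_simp
  linear_combination (2 * g (2 * δ * Real.log r) * (z ω ^ k).re) * ha

theorem fderiv_modulated_self (hgs : ContDiff ℝ 2 g) (hd : ContDiff ℝ 2 (modulated z k g a δ))
    {ω : EuclideanSpace ℝ (Fin n)} (hω : ‖ω‖ = 1) {r : ℝ} (hr : 0 < r) :
    fderiv ℝ (modulated z k g a δ) (r • ω) (r • ω) =
      ((r ^ 2) ^ a * r ^ k) * (δ * (2 * deriv g (2 * δ * Real.log r)) +
        (2 * a + k) * g (2 * δ * Real.log r)) * (z ω ^ k).re := by
  have hg1 : ∀ t, HasDerivAt g (deriv g t) t := fun t =>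
    (hgs.differentiable two_ne_zero t).hasDerivAt
  have hψ := fun q (hq : 0 < q) => hasDerivAt_rpow_mul_comp_log (a := a) (δ := δ) hq (hg1 _)
  have hrω : r • ω ≠ 0 := smul_ne_zero hr.ne' (norm_ne_zero_iff.1 (by rw [hω]; exact one_ne_zero))
  rw [fderiv_radial_mul_re_pow hψ z k (u := modulated z k g a δ) (fun x => rfl) hrω
    (hd.differentiable two_ne_zero _),
    natCast_mul_pow_pred_mul_self, real_inner_self_eq_norm_sq, ← Complex.ofReal_natCast k,
    Complex.re_ofReal_mul, re_pow_smul,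
    norm_smul_of_norm_eq_one hω hr, Real.rpow_sub_one (by positivity) a, Real.log_pow]
  have e : δ * (((2 : ℕ) : ℝ) * Real.log r) = 2 * δ * Real.log r := by push_cast; ring
  simp only [e]
  field_simp
  ring

end formulas

theorem statement14 (n : ℕ) (hn : 2 ≤ n) (α : ℝ) (hα : α ≠ 4 - (n : ℝ))
    (γ : ℝ) (hγ : γ = ((n : ℝ) - 4 + α) * ((n : ℝ) - α) / 4)
    (hspec : ∃ k : ℕ, γ + (k : ℝ) * ((n : ℝ) - 2 + (k : ℝ)) = 0)
    (ε : ℝ) (hε : 0 < ε) :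
    ∃ u : EuclideanSpace ℝ (Fin n) → ℝ,
      ContDiff ℝ 2 u ∧ HasCompactSupport u ∧
      (0 : EuclideanSpace ℝ (Fin n)) ∉ tsupport u ∧
      (∫ x : EuclideanSpace ℝ (Fin n), ‖x‖ ^ (α - 2) * ‖gradient u x‖ ^ 2) ≠ 0 ∧
      (∫ x : EuclideanSpace ℝ (Fin n), ‖x‖ ^ α * (lap u x) ^ 2) <
        ε * (∫ x : EuclideanSpace ℝ (Fin n), ‖x‖ ^ (α - 2) * ‖gradient u x‖ ^ 2) := by
  obtain ⟨k, hk⟩ := hspec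
  obtain ⟨z, hz, e, he, hze⟩ := exists_isotropic hn
  obtain ⟨g, hgs, hgc, hg0, hg3, hgpos⟩ := exists_bump
  have : Nontrivial (EuclideanSpace ℝ (Fin n)) :=
    ⟨e, 0, norm_ne_zero_iff.1 (by rw [he]; exact one_ne_zero)⟩
  have hA := sphere_integral_re_pow_sq_pos z k he hze
  set A := ∫ ω : Metric.sphere (0 : EuclideanSpace ℝ (Fin n)) 1, (z ω ^ k).re ^ 2
      ∂(volume : Measure (EuclideanSpace ℝ (Fin n))).toSphere
  obtain ⟨s, hs⟩ : ∃ s : ℝ, s = (4 - n - α) / 2 := ⟨_, rfl⟩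
  obtain ⟨a, ha⟩ : ∃ a : ℝ, a = (s - k) / 2 := ⟨_, rfl⟩
  have hs0 : s ≠ 0 := fun h => hα (by linarith)
  have hspec' : a * (2 * a - 2 + n + 2 * k) = 0 := by
    subst hγ ha hs
    linear_combination (-1 / 2) * hk
  obtain ⟨b, hb⟩ : ∃ b : ℝ, b = 8 * a - 4 + 2 * n + 4 * k := ⟨_, rfl⟩
  have hdg : ContDiff ℝ 1 (deriv g) := ((contDiff_succ_iff_deriv (n := 1)).1 hgs).2.2
  have hdg_cont : Continuous (deriv g) := hdg.continuous
  have hddg_cont : Continuous (deriv (deriv g)) := hdg.continuous_deriv le_rfl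
  have hT1 : Tendsto (fun δ : ℝ => δ ^ 2 * ∫ t, (δ * (4 * deriv (deriv g) t) + b * deriv g t) ^ 2)
      (𝓝 0) (𝓝 0) := by
    have h := ((continuous_pow 2).tendsto (0 : ℝ)).mul (tendsto_integral_smul_add_sq
      (hddg_cont.const_mul 4) (hdg_cont.const_mul b) hgc.deriv.deriv.mul_left hgc.deriv.mul_left)
    simpa using h
  have hT2 : Tendsto (fun δ : ℝ => ∫ t, (δ * (2 * deriv g t) + s * g t) ^ 2)
      (𝓝 0) (𝓝 (s ^ 2 * ∫ t, g t * g t)) := by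
    have h := tendsto_integral_smul_add_sq
      (hdg_cont.const_mul 2) (hgs.continuous.const_mul s) hgc.deriv.mul_left hgc.mul_left
    have e : ∫ t, s * g t * (s * g t) = s ^ 2 * ∫ t, g t * g t := by
      rw [← integral_const_mul]
      exact integral_congr_ae (.of_forall fun t => by ring)
    rwa [e] at h
  have hlim : 0 < s ^ 2 * ∫ t, g t * g t := by positivity
  have hev : ∀ᶠ δ : ℝ in 𝓝[>] 0, 0 < δ ∧
      0 < (∫ t, (δ * (2 * deriv g t) + s * g t) ^ 2) ∧
      (δ ^ 2 * ∫ t, (δ * (4 * deriv (deriv g) t) + b * deriv g t) ^ 2) <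
        ε * ∫ t, (δ * (2 * deriv g t) + s * g t) ^ 2 := by
    refine Eventually.and self_mem_nhdsWithin (nhdsWithin_le_nhds ?_)
    refine (hT2.eventually_const_lt hlim).and ?_
    exact hT1.eventually_lt (hT2.const_mul ε) (by positivity)
  obtain ⟨δ, hδ, hpos, hlt⟩ := hev.exists
  have hu := contDiff_modulated z k a hgs hg0 hδ
  have huc := hasCompactSupport_modulated z k a (by norm_num) hg3 hδ
  have hu0 : (0 : EuclideanSpace ℝ (Fin n)) ∉ tsupport (modulated z k g a δ) :=
    notMem_tsupport_iff_eventuallyEq.2 (modulated_eventuallyEq_zero z k a hg0 hδ)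
  have hI1 : (∫ x : EuclideanSpace ℝ (Fin n), ‖x‖ ^ α * (lap (modulated z k g a δ) x) ^ 2) =
      A * ((2 * δ)⁻¹ * ∫ t, δ ^ 2 * (δ * (4 * deriv (deriv g) t) + b * deriv g t) ^ 2) := by
    refine integral_eq_of_polar volume (Y := fun x => (z x ^ k).re ^ 2) (by positivity)
      fun ω hω r hr => ?_
    rw [lap_modulated hz hgs hu hspec' hω hr, norm_smul_of_norm_eq_one hω hr,
      finrank_euclideanSpace_fin, ← hb]
    have := sq_rpow_mul_pow_sq hr (a - 1) α k
    rw [show α + 4 * (a - 1) + 2 * k = -(n : ℝ) by rw [ha, hs]; ring] at this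
    rw [← this]
    ring
  have hI2 : (∫ x : EuclideanSpace ℝ (Fin n),
      ‖x‖ ^ (α - 4) * (fderiv ℝ (modulated z k g a δ) x x) ^ 2) =
      A * ((2 * δ)⁻¹ * ∫ t, (δ * (2 * deriv g t) + s * g t) ^ 2) := by
    refine integral_eq_of_polar volume (Y := fun x => (z x ^ k).re ^ 2) (by positivity)
      fun ω hω r hr => ?_
    rw [fderiv_modulated_self hgs hu hω hr, norm_smul_of_norm_eq_one hω hr,
      finrank_euclideanSpace_fin, show 2 * a + k = s by rw [ha]; ring]
    have := sq_rpow_mul_pow_sq hr a (α - 4) k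
    rw [show α - 4 + 4 * a + 2 * k = -(n : ℝ) by rw [ha, hs]; ring] at this
    rw [← this]
    ring
  have hI3 : A * ((2 * δ)⁻¹ * ∫ t, (δ * (2 * deriv g t) + s * g t) ^ 2) ≤
      ∫ x : EuclideanSpace ℝ (Fin n),
        ‖x‖ ^ (α - 2) * ‖gradient (modulated z k g a δ) x‖ ^ 2 := by
    rw [← hI2]
    refine integral_mono_of_nonneg (.of_forall fun x => by positivity)
      (integrable_norm_rpow_mul_norm_gradient_sq volume hu huc hu0 _) (.of_forall fun x => ?_)
    by_cases hx : x = 0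
    · subst hx
      simp only [map_zero]
      rw [zero_pow two_ne_zero, mul_zero]
      positivity
    · have hx' : 0 < ‖x‖ := norm_pos_iff.2 hx
      have h1 := sq_le_sq' (neg_le_of_abs_le (abs_fderiv_self_le_norm_gradient_mul
        (modulated z k g a δ) x)) (le_of_abs_le (abs_fderiv_self_le_norm_gradient_mul
        (modulated z k g a δ) x))
      have h2 : ‖x‖ ^ (α - 2) = ‖x‖ ^ (α - 4) * ‖x‖ ^ 2 := by
        rw [← Real.rpow_natCast ‖x‖ 2, ← Real.rpow_add hx']
        congr 1; push_cast; ring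
      calc ‖x‖ ^ (α - 4) * (fderiv ℝ (modulated z k g a δ) x x) ^ 2
          ≤ ‖x‖ ^ (α - 4) * (‖gradient (modulated z k g a δ) x‖ * ‖x‖) ^ 2 := by gcongr
        _ = ‖x‖ ^ (α - 2) * ‖gradient (modulated z k g a δ) x‖ ^ 2 := by rw [h2]; ring
  refine ⟨modulated z k g a δ, hu, huc, hu0, ?_, ?_⟩
  · exact (lt_of_lt_of_le (by positivity) hI3).ne'
  · refine lt_of_lt_of_le ?_ (mul_le_mul_of_nonneg_left hI3 hε.le)
    rw [hI1, integral_const_mul]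
    have hc : 0 < A * (2 * δ)⁻¹ := by positivity
    calc _ = A * (2 * δ)⁻¹ *
          (δ ^ 2 * ∫ t, (δ * (4 * deriv (deriv g) t) + b * deriv g t) ^ 2) := by ring
      _ < A * (2 * δ)⁻¹ * (ε * ∫ t, (δ * (2 * deriv g t) + s * g t) ^ 2) := by gcongr
      _ = _ := by ring
end
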